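/- Let F be a field of characteristic different from 3 with the C_4 property. Then K_5^M(F)/3K_5^M(F) = 0. -/

import Mathlib

universe u

open MvPolynomial

/-- A field `F` has the `C_n` property if every homogeneous polynomial of
positive degree `d` in more than `d ^ n` variables has a nontrivial zero. -/
def IsCField (F : Type u) [Field F] (n : ℕ) : Prop :=
  ∀ (d N : ℕ), 0 < d → d ^ n < N →
    ∀ f : MvPolynomial (Fin N) F, f.IsHomogeneous d →
      ∃ x : Fin N → F, x ≠ 0 ∧ MvPolynomial.eval x f = 0

variable (F : Type u) [Field F]

/-- Multilinearity relations for Milnor K-theory. -/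
def mlRel (n : ℕ) : Set (FreeAbelianGroup (Fin n → Fˣ)) :=
  {z | ∃ (a : Fin n → Fˣ) (i : Fin n) (u v : Fˣ), a i = u * v ∧
        z = FreeAbelianGroup.of a - FreeAbelianGroup.of (Function.update a i u)
              - FreeAbelianGroup.of (Function.update a i v)}

/-- Steinberg relations for Milnor K-theory. -/
def stRel (n : ℕ) : Set (FreeAbelianGroup (Fin n → Fˣ)) :=
  {z | ∃ (a : Fin n → Fˣ) (i j : Fin n), (i : ℕ) + 1 = (j : ℕ) ∧
        ((a i : F) + (a j : F) = 1) ∧ z = FreeAbelianGroup.of a}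

/-- The subgroup of relations defining the `n`-th Milnor K-group. -/
def milnorRel (n : ℕ) : AddSubgroup (FreeAbelianGroup (Fin n → Fˣ)) :=
  AddSubgroup.closure (mlRel F n ∪ stRel F n)

/-- The `n`-th Milnor K-group `K_n^M(F)`. -/
def MilnorK (n : ℕ) : Type u :=
  FreeAbelianGroup (Fin n → Fˣ) ⧸ milnorRel F n

instance (n : ℕ) : AddCommGroup (MilnorK F n) :=
  QuotientAddGroup.Quotient.addCommGroup _

/-- The subgroup `p·K_n^M(F)` of `K_n^M(F)`. -/
def pMul (p n : ℕ) : AddSubgroup (MilnorK F n) :=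
  AddSubgroup.closure {x | ∃ y : MilnorK F n, x = p • y}

/-- `k_n(F) = K_n^M(F)/pK_n^M(F)`. -/
def kMod (p n : ℕ) : Type u := MilnorK F n ⧸ pMul F p n

instance (p n : ℕ) : AddCommGroup (kMod F p n) :=
  QuotientAddGroup.Quotient.addCommGroup _

/-- The symbol `(a 1, …, a n)` in `k_n(F)`. -/
def symbol (p : ℕ) {n : ℕ} (a : Fin n → Fˣ) : kMod F p n :=
  QuotientAddGroup.mk (QuotientAddGroup.mk (FreeAbelianGroup.of a))

/-- A logarithmic map from a field `K` to a ring `R` with `3 = 0` satisfying the Steinberg relation,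
that is, a representation of the Milnor ring of `K` modulo `3`. The value at `0` is irrelevant. -/
structure MilnorRep (K : Type*) [Field K] (R : Type*) [Ring R] where
  /-- The underlying function. -/
  toFun : K → R
  map_mul' : ∀ x y : K, x ≠ 0 → y ≠ 0 → toFun (x * y) = toFun x + toFun y
  steinberg' : ∀ x y : K, x ≠ 0 → y ≠ 0 → x + y = 1 → toFun x * toFun y = 0
  three : (3 : R) = 0

namespace MilnorRep

variable {K : Type*} [Field K] {R : Type*} [Ring R]

instance : CoeFun (MilnorRep K R) (fun _ => K → R) := ⟨MilnorRep.toFun⟩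

variable (L : MilnorRep K R)

theorem map_mul {x y : K} (hx : x ≠ 0) (hy : y ≠ 0) : L (x * y) = L x + L y :=
  L.map_mul' x y hx hy

theorem steinberg {x y : K} (hx : x ≠ 0) (hy : y ≠ 0) (h : x + y = 1) : L x * L y = 0 :=
  L.steinberg' x y hx hy h

theorem map_one : L 1 = 0 := by
  have := L.map_mul (one_ne_zero (α := K)) one_ne_zero
  simpa using this

theorem three_mul (L : MilnorRep K R) (r : R) : 3 * r = 0 := by rw [L.three, zero_mul]

theorem eq_zero_of_add_self (L : MilnorRep K R) {r : R} (h : r + r = 0) : r = 0 := by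
  have h3 := L.three_mul r
  have : (3 : R) * r = r + r + r := by
    rw [show (3 : R) = 1 + 1 + 1 by norm_num, add_mul, add_mul, one_mul]
  rw [this, h, zero_add] at h3
  exact h3

theorem map_neg_one : L (-1) = 0 := by
  apply L.eq_zero_of_add_self
  rw [← L.map_mul (neg_ne_zero.2 one_ne_zero) (neg_ne_zero.2 one_ne_zero)]
  simp [L.map_one]

theorem map_neg {x : K} (hx : x ≠ 0) : L (-x) = L x := by
  rw [← neg_one_mul, L.map_mul (neg_ne_zero.2 one_ne_zero) hx, L.map_neg_one, zero_add]

theorem map_inv {x : K} (hx : x ≠ 0) : L x⁻¹ = -L x := by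
  have := L.map_mul hx (inv_ne_zero hx)
  rw [mul_inv_cancel₀ hx, L.map_one] at this
  exact (neg_eq_of_add_eq_zero_right this.symm).symm

theorem map_div {x y : K} (hx : x ≠ 0) (hy : y ≠ 0) : L (x / y) = L x - L y := by
  rw [div_eq_mul_inv, L.map_mul hx (inv_ne_zero hy), L.map_inv hy, sub_eq_add_neg]

theorem map_sq {x : K} (hx : x ≠ 0) : L (x ^ 2) = L x + L x := by
  rw [pow_two, L.map_mul hx hx]

theorem map_cube {x : K} (hx : x ≠ 0) : L (x ^ 3) = 0 := by
  rw [pow_succ, L.map_mul (pow_ne_zero 2 hx) hx, L.map_sq hx, ← L.three_mul (L x),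
    show (3 : R) = 1 + 1 + 1 by norm_num, add_mul, add_mul, one_mul]

theorem mul_self {x : K} (hx : x ≠ 0) : L x * L x = 0 := by
  by_cases h1 : x = 1
  · rw [h1, L.map_one, zero_mul]
  have h2 : 1 - x ≠ 0 := sub_ne_zero.2 (Ne.symm h1)
  have h3 : 1 - x⁻¹ ≠ 0 := by
    intro h
    exact h1 (inv_eq_one.1 (sub_eq_zero.1 h).symm)
  have e : -x = (1 - x) / (1 - x⁻¹) := by
    field_simp
    ring
  have a := L.steinberg hx h2 (by ring)
  have b := L.steinberg (inv_ne_zero hx) h3 (by ring)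
  rw [L.map_inv hx] at b
  nth_rewrite 2 [← L.map_neg hx]
  rw [e, L.map_div h2 h3, mul_sub, a, zero_sub, ← neg_mul, b]

theorem anticomm {x y : K} (hx : x ≠ 0) (hy : y ≠ 0) : L x * L y = -(L y * L x) := by
  have h := L.mul_self (mul_ne_zero hx hy)
  rw [L.map_mul hx hy, add_mul, mul_add, mul_add, L.mul_self hx, L.mul_self hy, zero_add,
    add_zero] at h
  exact eq_neg_of_add_eq_zero_left h

/-- The function `φ` only represents elements annihilated by `w`, and it is anisotropic
unless `w` vanishes. -/
def IsNormLike {V : Type*} [Zero V] (w : R) (φ : V → K) : Prop :=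
  (∀ z, φ z ≠ 0 → w * L (φ z) = 0) ∧ ∀ z, z ≠ 0 → φ z = 0 → w = 0

variable {L}

theorem mul_mul_eq_zero_of_add {w : R} {c p q : K} (hc : c ≠ 0)
    (hp : p ≠ 0 → w * L p = 0) (hq : q ≠ 0 → w * L q = 0) (h : p + c * q ≠ 0) :
    w * L c * L (p + c * q) = 0 := by
  by_cases p0 : p = 0
  · subst p0
    have q0 : q ≠ 0 := by rintro rfl; simp at h
    rw [zero_add, L.map_mul hc q0, mul_add, mul_assoc, L.mul_self hc, mul_zero, zero_add,
      mul_assoc, L.anticomm hc q0, mul_neg, ← mul_assoc, hq q0, zero_mul, neg_zero]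
  by_cases q0 : q = 0
  · subst q0
    rw [mul_zero, add_zero, mul_assoc, L.anticomm hc p0, mul_neg, ← mul_assoc, hp p0, zero_mul,
      neg_zero]
  have hcq : c * q / p ≠ 0 := div_ne_zero (mul_ne_zero hc q0) p0
  have e : p + c * q = p * (1 + c * q / p) := by field_simp
  have hy : 1 + c * q / p ≠ 0 := fun h' => h (by rw [e, h', mul_zero])
  have e2 : w * L c = w * L (c * q / p) := by
    rw [L.map_div (mul_ne_zero hc q0) p0, L.map_mul hc q0, mul_sub, mul_add, hq q0, hp p0]
    simp
  have st := L.steinberg (neg_ne_zero.2 hcq) hy (by ring)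
  rw [L.map_neg hcq] at st
  rw [e, L.map_mul p0 hy, mul_add]
  nth_rewrite 2 [e2]
  rw [mul_assoc w (L (c * q / p)), st, mul_assoc, L.anticomm hc p0, mul_neg, ← mul_assoc, hp p0]
  simp

theorem mul_eq_zero_of_add_eq_zero {w : R} {c p q : K} (hc : c ≠ 0)
    (hp : p ≠ 0 → w * L p = 0) (hq : q ≠ 0 → w * L q = 0) (hne : p ≠ 0 ∨ q ≠ 0)
    (h : p + c * q = 0) : w * L c = 0 := by
  have q0 : q ≠ 0 := by
    rintro rfl
    simp at h
    simp [h] at hne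
  have e : p = -(c * q) := eq_neg_of_add_eq_zero_left h
  have p0 : p ≠ 0 := by rw [e]; exact neg_ne_zero.2 (mul_ne_zero hc q0)
  have := hp p0
  rwa [e, L.map_neg (mul_ne_zero hc q0), L.map_mul hc q0, mul_add, hq q0, add_zero] at this

theorem IsNormLike.double {V : Type*} [Zero V] {w : R} {φ : V → K} (h : L.IsNormLike w φ)
    {c : K} (hc : c ≠ 0) :
    L.IsNormLike (w * L c) (fun z : V × V => φ z.1 + c * φ z.2) := by
  refine ⟨fun z hz => mul_mul_eq_zero_of_add hc (h.1 _) (h.1 _) hz, fun z hz hz0 => ?_⟩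
  by_cases hne : φ z.1 ≠ 0 ∨ φ z.2 ≠ 0
  · exact mul_eq_zero_of_add_eq_zero hc (h.1 _) (h.1 _) hne hz0
  push Not at hne
  by_cases z1 : z.1 = 0
  · have z2 : z.2 ≠ 0 := fun z2 => hz (Prod.ext z1 z2)
    rw [h.2 _ z2 hne.2, zero_mul]
  · rw [h.2 _ z1 hne.1, zero_mul]

/-- The Tits-style tripling of a cubic norm. -/
theorem IsNormLike.triple {A : Type*} [AddCommGroup A] [Module K A] {w : R} {N T S : A → K} {e : A}
    {m : A → A → A → A} (h : L.IsNormLike w N)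
    (hm : ∀ x y z, N (m x y z) = N x * N y * N z)
    (hchar : ∀ (g : K) (z : A), N (g • e - z) = g ^ 3 - T z * g ^ 2 + S z * g - N z)
    (hNs : ∀ (g : K) (z : A), N (g • z) = g ^ 3 * N z)
    (hTs : ∀ (g : K) (z : A), T (g • z) = g * T z)
    (he : e ≠ 0) (hm1 : ∀ x y, m x y 0 = 0) (hm2 : ∀ y z, m 0 y z = 0)
    {c : K} (hc : c ≠ 0) :
    L.IsNormLike (w * L c) (fun x : A × A × A =>
      N x.1 + c * N x.2.1 + c ^ 2 * N x.2.2 - c * T (m x.2.2 x.1 x.2.1)) := by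
  have N0 : N 0 = 0 := by simpa using hNs 0 0
  have T0 : T 0 = 0 := by simpa using hTs 0 0
  by_cases hw : w = 0
  · refine ⟨fun z _ => by simp [hw], fun z _ _ => by simp [hw]⟩
  have aniso : ∀ z, N z = 0 → z = 0 := fun z hz => by
    by_contra hz'
    exact hw (h.2 z hz' hz)
  have hd := h.double hc
  have hd2 := h.double (pow_ne_zero 2 hc)
  have half : w * L (c ^ 2) = -(w * L c) := by
    have := L.three_mul (w * L c)
    rw [show (3 : R) = 1 + 1 + 1 by norm_num, add_mul, add_mul, one_mul] at this
    rw [L.map_sq hc, mul_add]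
    exact eq_neg_of_add_eq_zero_left this
  have key : ∀ x : A × A × A, N x.2.1 ≠ 0 → N x.2.2 ≠ 0 → ∃ γ m' p q : K, γ ≠ 0 ∧
      w * L γ = w * L c ∧ (∃ z, p = N z) ∧ (∃ z, q = N z) ∧
      (p = 0 → q = 0 → γ = 1) ∧ (1 - γ) * m' = p + γ * q ∧
      N x.1 + c * N x.2.1 + c ^ 2 * N x.2.2 - c * T (m x.2.2 x.1 x.2.1)
        = N x.2.1 ^ 2 / N x.2.2 * m' := by
    intro x n1 n2
    set Z : A := (N x.2.1)⁻¹ • m x.2.2 x.1 x.2.1 with hZ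
    set γ : K := c * N x.2.2 / N x.2.1 with hγ
    have hγ0 : γ ≠ 0 := div_ne_zero (mul_ne_zero hc n2) n1
    refine ⟨γ, N Z + γ + γ ^ 2 - γ * T Z, N (Z - γ • e), N ((1 : K) • e - Z), hγ0, ?_, ⟨_, rfl⟩,
      ⟨_, rfl⟩, ?_, ?_, ?_⟩
    · rw [hγ, L.map_div (mul_ne_zero hc n2) n1, L.map_mul hc n2, mul_sub, mul_add, h.1 _ n1,
        h.1 _ n2]
      simp
    · intro hp hq
      have hp' := sub_eq_zero.1 (aniso _ hp)
      have : N ((1 - γ) • e) = 0 := by rw [sub_smul, ← hp', hq]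
      have := aniso _ this
      rcases smul_eq_zero.1 this with h' | h'
      · exact (sub_eq_zero.1 h').symm
      · exact absurd h' he
    · have e1 : N (Z - γ • e) = -N (γ • e - Z) := by
        rw [← neg_sub, ← neg_one_smul K, hNs]
        ring
      rw [e1, hchar, hchar]
      ring
    · rw [hZ, hNs, hTs, hm, hγ]
      field_simp
  have reduce : ∀ x : A × A × A,
      (∃ z : A × A, (x ≠ 0 → z ≠ 0) ∧
        N x.1 + c * N x.2.1 + c ^ 2 * N x.2.2 - c * T (m x.2.2 x.1 x.2.1) = N z.1 + c * N z.2) ∨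
      (∃ z : A × A, (x ≠ 0 → z ≠ 0) ∧
        N x.1 + c * N x.2.1 + c ^ 2 * N x.2.2 - c * T (m x.2.2 x.1 x.2.1)
          = N z.1 + c ^ 2 * N z.2) ∨
      (N x.2.1 ≠ 0 ∧ N x.2.2 ≠ 0) := by
    rintro ⟨x0, x1, x2⟩
    by_cases n2 : N x2 = 0
    · have := aniso _ n2
      subst this
      refine Or.inl ⟨(x0, x1), fun hx hz => hx ?_, by simp [hm2, T0, N0]⟩
      simp_all
    by_cases n1 : N x1 = 0
    · have := aniso _ n1
      subst this
      refine Or.inr (Or.inl ⟨(x0, x2), fun hx hz => hx ?_, by simp [hm1, T0, N0]⟩)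
      simp_all
    exact Or.inr (Or.inr ⟨n1, n2⟩)
  constructor
  · intro x hx
    rcases reduce x with ⟨z, -, hz⟩ | ⟨z, -, hz⟩ | ⟨n1, n2⟩
    · simp only [hz] at hx ⊢
      exact hd.1 z hx
    · simp only [hz] at hx ⊢
      have := hd2.1 z hx
      rwa [half, neg_mul, neg_eq_zero] at this
    · obtain ⟨γ, m', p, q, hγ, hwγ, ⟨zp, rfl⟩, ⟨zq, rfl⟩, hpq, hm', hval⟩ := key x n1 n2
      simp only [hval] at hx ⊢
      have m0 : m' ≠ 0 := right_ne_zero_of_mul hx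
      have k0 : N x.2.1 ^ 2 / N x.2.2 ≠ 0 := left_ne_zero_of_mul hx
      rw [← hwγ]
      by_cases g1 : γ = 1
      · simp [g1, L.map_one]
      have g1' : 1 - γ ≠ 0 := sub_ne_zero.2 (Ne.symm g1)
      have s := mul_mul_eq_zero_of_add hγ (h.1 zp) (h.1 zq)
        (by rw [← hm']; exact mul_ne_zero g1' m0)
      rw [← hm', L.map_mul g1' m0, mul_add, mul_assoc w, L.steinberg hγ g1' (by ring), mul_zero,
        zero_add] at s
      have t : w * L (N x.2.1 ^ 2 / N x.2.2) = 0 := by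
        rw [L.map_div (pow_ne_zero 2 n1) n2, L.map_sq n1, mul_sub, mul_add, h.1 _ n1, h.1 _ n2]
        simp
      rw [L.map_mul k0 m0, mul_add, s, add_zero, mul_assoc, L.anticomm hγ k0, mul_neg,
        ← mul_assoc, t, zero_mul, neg_zero]
  · intro x hx hx0
    rcases reduce x with ⟨z, hz1, hz⟩ | ⟨z, hz1, hz⟩ | ⟨n1, n2⟩
    · exact hd.2 z (hz1 hx) (hz.symm.trans hx0)
    · have := hd2.2 z (hz1 hx) (hz.symm.trans hx0)
      rwa [half, neg_eq_zero] at this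
    · obtain ⟨γ, m', p, q, hγ, hwγ, ⟨zp, rfl⟩, ⟨zq, rfl⟩, hpq, hm', hval⟩ := key x n1 n2
      simp only [hval] at hx0
      have m0 : m' = 0 := by
        rcases mul_eq_zero.1 hx0 with h' | h'
        · exact absurd h' (div_ne_zero (pow_ne_zero 2 n1) n2)
        · exact h'
      rw [← hwγ]
      by_cases hne : N zp ≠ 0 ∨ N zq ≠ 0
      · refine mul_eq_zero_of_add_eq_zero hγ (h.1 zp) (h.1 zq) hne ?_
        rw [← hm', m0, mul_zero]
      · push Not at hne
        rw [hpq hne.1 hne.2, L.map_one, mul_zero]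

end MilnorRep

/-- Functions which are the restriction of a trilinear form to the diagonal. -/
def IsCubicForm (K : Type*) [Field K] {V : Type*} [AddCommGroup V] [Module K V] (f : V → K) :
    Prop :=
  ∃ g : V → V → V → K, (∀ x y, IsLinearMap K (g x y)) ∧ (∀ x z, IsLinearMap K fun y => g x y z) ∧
    (∀ y z, IsLinearMap K fun x => g x y z) ∧ ∀ x, f x = g x x x

namespace IsCubicForm

variable {K : Type*} [Field K] {V W : Type*} [AddCommGroup V] [Module K V] [AddCommGroup W]
  [Module K W]

theorem add {f f' : V → K} (h : IsCubicForm K f) (h' : IsCubicForm K f') :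
    IsCubicForm K (fun x => f x + f' x) := by
  obtain ⟨g, h1, h2, h3, h4⟩ := h
  obtain ⟨g', h1', h2', h3', h4'⟩ := h'
  refine ⟨fun x y z => g x y z + g' x y z, fun x y => ?_, fun x z => ?_, fun y z => ?_,
    fun x => by simp only [h4, h4']⟩
  · exact ((h1 x y).mk' + (h1' x y).mk').isLinear
  · exact ((h2 x z).mk' + (h2' x z).mk').isLinear
  · exact ((h3 y z).mk' + (h3' y z).mk').isLinear

theorem const_mul {f : V → K} (h : IsCubicForm K f) (c : K) :
    IsCubicForm K (fun x => c * f x) := by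
  obtain ⟨g, h1, h2, h3, h4⟩ := h
  refine ⟨fun x y z => c * g x y z, fun x y => ?_, fun x z => ?_, fun y z => ?_,
    fun x => by simp only [h4]⟩
  · exact (c • (h1 x y).mk').isLinear
  · exact (c • (h2 x z).mk').isLinear
  · exact (c • (h3 y z).mk').isLinear

theorem sub {f f' : V → K} (h : IsCubicForm K f) (h' : IsCubicForm K f') :
    IsCubicForm K (fun x => f x - f' x) := by
  simpa [sub_eq_add_neg] using h.add (h'.const_mul (-1))

theorem comp {f : W → K} (h : IsCubicForm K f) (l : V →ₗ[K] W) :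
    IsCubicForm K (fun x => f (l x)) := by
  obtain ⟨g, h1, h2, h3, h4⟩ := h
  refine ⟨fun x y z => g (l x) (l y) (l z), fun x y => ?_, fun x z => ?_, fun y z => ?_,
    fun x => by simp only [h4]⟩
  · exact ((h1 (l x) (l y)).mk' ∘ₗ l).isLinear
  · exact ((h2 (l x) (l z)).mk' ∘ₗ l).isLinear
  · exact ((h3 (l y) (l z)).mk' ∘ₗ l).isLinear

end IsCubicForm

/-- A commutative algebra with an automorphism of order dividing `3`, all of whose characteristic
coefficients lie in the base field. -/
structure CyclicCubic (K E : Type*) [Field K] [CommRing E] [Algebra K E] where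
  /-- The automorphism. -/
  σ : E →ₐ[K] E
  /-- A linear retraction onto the base field. -/
  t : E →ₗ[K] K
  σ_cube : ∀ z, σ (σ (σ z)) = z
  t_algebraMap : ∀ k, t (algebraMap K E k) = k
  norm_mem : ∀ z, algebraMap K E (t (z * σ z * σ (σ z))) = z * σ z * σ (σ z)
  trace_mem : ∀ z, algebraMap K E (t (z + σ z + σ (σ z))) = z + σ z + σ (σ z)
  quad_mem : ∀ z, algebraMap K E (t (z * σ z + σ z * σ (σ z) + σ (σ z) * z)) =
    z * σ z + σ z * σ (σ z) + σ (σ z) * z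

namespace CyclicCubic

variable {K E : Type*} [Field K] [CommRing E] [Algebra K E] (C : CyclicCubic K E)

/-- The norm. -/
def norm (z : E) : K := C.t (z * C.σ z * C.σ (C.σ z))

/-- The trace. -/
def trace (z : E) : K := C.t (z + C.σ z + C.σ (C.σ z))

/-- The second characteristic coefficient. -/
def quad (z : E) : K := C.t (z * C.σ z + C.σ z * C.σ (C.σ z) + C.σ (C.σ z) * z)

theorem algebraMap_norm (z : E) : algebraMap K E (C.norm z) = z * C.σ z * C.σ (C.σ z) :=
  C.norm_mem z

theorem algebraMap_trace (z : E) : algebraMap K E (C.trace z) = z + C.σ z + C.σ (C.σ z) :=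
  C.trace_mem z

theorem algebraMap_quad (z : E) : algebraMap K E (C.quad z) =
    z * C.σ z + C.σ z * C.σ (C.σ z) + C.σ (C.σ z) * z :=
  C.quad_mem z

theorem algebraMap_inj (C : CyclicCubic K E) {x y : K} (h : algebraMap K E x = algebraMap K E y) :
    x = y := by
  rw [← C.t_algebraMap x, h, C.t_algebraMap]

theorem trace_add (x y : E) : C.trace (x + y) = C.trace x + C.trace y := by
  simp only [trace, map_add]
  ring

theorem trace_smul (g : K) (x : E) : C.trace (g • x) = g * C.trace x := by
  simp only [trace, map_smul, ← smul_add, smul_eq_mul]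

theorem norm_smul (g : K) (x : E) : C.norm (g • x) = g ^ 3 * C.norm x := by
  apply C.algebraMap_inj
  simp only [algebraMap_norm, _root_.map_mul, map_pow, Algebra.smul_def,
    AlgHom.commutes]
  ring

theorem norm_smul_one_sub (g : K) (z : E) :
    C.norm (g • 1 - z) = g ^ 3 - C.trace z * g ^ 2 + C.quad z * g - C.norm z := by
  apply C.algebraMap_inj
  simp only [algebraMap_norm, algebraMap_trace, algebraMap_quad, map_sub, map_add, _root_.map_mul,
    map_pow, Algebra.smul_def, _root_.map_one, AlgHom.commutes]
  ring

theorem isCubicForm_norm : IsCubicForm K C.norm := by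
  refine ⟨fun x y z => C.t (x * C.σ y * C.σ (C.σ z)), fun x y => ⟨?_, ?_⟩, fun x z => ⟨?_, ?_⟩,
    fun y z => ⟨?_, ?_⟩, fun x => rfl⟩ <;> intros <;> simp [mul_add, add_mul]

theorem isCubicForm_trace : IsCubicForm K fun x : E × E × E => C.trace (x.2.2 * x.1 * x.2.1) := by
  refine ⟨fun x y z => C.trace (x.2.2 * y.1 * z.2.1), fun x y => ⟨?_, ?_⟩, fun x z => ⟨?_, ?_⟩,
    fun y z => ⟨?_, ?_⟩, fun x => rfl⟩ <;> intros <;>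
    simp [mul_add, add_mul, trace_add, trace_smul]

variable (b : K)

/-- The reduced norm of the cyclic algebra `E ⊕ E v ⊕ E v²` with `v³ = b`. -/
def cyclicNorm (x : E × E × E) : K :=
  C.norm x.1 + b * C.norm x.2.1 + b ^ 2 * C.norm x.2.2 - b * C.trace (x.2.2 * x.1 * x.2.1)

/-- The multiplication of the cyclic algebra `E ⊕ E v ⊕ E v²` with `v³ = b`. -/
def cyclicMul (x y : E × E × E) : E × E × E :=
  (x.1 * y.1 + b • (C.σ (C.σ x.2.1) * C.σ (C.σ y.2.2)) + b • (C.σ x.2.2 * C.σ y.2.1),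
    C.σ x.1 * y.2.1 + x.2.1 * C.σ (C.σ y.1) + b • (C.σ (C.σ x.2.2) * C.σ y.2.2),
    C.σ (C.σ x.1) * y.2.2 + C.σ x.2.1 * C.σ (C.σ y.2.1) + x.2.2 * C.σ y.1)

/-- The left regular representation of the cyclic algebra. -/
def cyclicMatrix (x : E × E × E) : Matrix (Fin 3) (Fin 3) E :=
  !![x.1, C.σ (C.σ x.2.1), C.σ x.2.2;
    b • C.σ (C.σ x.2.2), C.σ x.1, x.2.1;
    b • C.σ x.2.1, b • x.2.2, C.σ (C.σ x.1)]

theorem det_cyclicMatrix (x : E × E × E) :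
    (C.cyclicMatrix b x).det = algebraMap K E (C.cyclicNorm b x) := by
  simp only [cyclicMatrix, cyclicNorm, Matrix.det_fin_three, map_sub, map_add, _root_.map_mul,
    map_pow, algebraMap_norm, algebraMap_trace, Algebra.smul_def]
  simp
  ring

theorem cyclicMatrix_mul (x y : E × E × E) :
    C.cyclicMatrix b (C.cyclicMul b x y) = C.cyclicMatrix b x * C.cyclicMatrix b y := by
  ext i j
  fin_cases i <;> fin_cases j <;>
    simp [cyclicMatrix, cyclicMul, Matrix.mul_apply, Fin.sum_univ_three, Algebra.smul_def,
      C.σ_cube] <;> ring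

theorem cyclicNorm_mul (x y : E × E × E) :
    C.cyclicNorm b (C.cyclicMul b x y) = C.cyclicNorm b x * C.cyclicNorm b y := by
  apply C.algebraMap_inj
  rw [← det_cyclicMatrix, cyclicMatrix_mul, Matrix.det_mul, det_cyclicMatrix, det_cyclicMatrix,
    _root_.map_mul]

theorem isCubicForm_cyclicNorm : IsCubicForm K (C.cyclicNorm b) := by
  have h1 := C.isCubicForm_norm.comp (LinearMap.fst K E (E × E))
  have h2 := C.isCubicForm_norm.comp (LinearMap.fst K E E ∘ₗ LinearMap.snd K E (E × E))
  have h3 := C.isCubicForm_norm.comp (LinearMap.snd K E E ∘ₗ LinearMap.snd K E (E × E))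
  exact ((h1.add (h2.const_mul b)).add (h3.const_mul (b ^ 2))).sub
    (C.isCubicForm_trace.const_mul b)

/-- The norm of the first Tits construction over the cyclic algebra. -/
def titsNorm (c : K) (x : (E × E × E) × (E × E × E) × (E × E × E)) : K :=
  C.cyclicNorm b x.1 + c * C.cyclicNorm b x.2.1 + c ^ 2 * C.cyclicNorm b x.2.2 -
    c * C.trace (C.cyclicMul b (C.cyclicMul b x.2.2 x.1) x.2.1).1

theorem isCubicForm_titsNorm (c : K) : IsCubicForm K (C.titsNorm b c) := by
  have h1 := (C.isCubicForm_cyclicNorm b).comp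
    (LinearMap.fst K (E × E × E) ((E × E × E) × (E × E × E)))
  have h2 := (C.isCubicForm_cyclicNorm b).comp
    (LinearMap.fst K (E × E × E) (E × E × E) ∘ₗ
      LinearMap.snd K (E × E × E) ((E × E × E) × (E × E × E)))
  have h3 := (C.isCubicForm_cyclicNorm b).comp
    (LinearMap.snd K (E × E × E) (E × E × E) ∘ₗ
      LinearMap.snd K (E × E × E) ((E × E × E) × (E × E × E)))
  have h4 : IsCubicForm K fun x : (E × E × E) × (E × E × E) × (E × E × E) =>
      C.trace (C.cyclicMul b (C.cyclicMul b x.2.2 x.1) x.2.1).1 := by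
    refine ⟨fun x y z => C.trace (C.cyclicMul b (C.cyclicMul b x.2.2 y.1) z.2.1).1,
      fun x y => ⟨?_, ?_⟩, fun x z => ⟨?_, ?_⟩, fun y z => ⟨?_, ?_⟩, fun x => rfl⟩ <;> intros <;>
      simp only [← trace_add, ← trace_smul, smul_eq_mul] <;> congr 1 <;>
      simp [cyclicMul, Algebra.smul_def] <;> ring
  exact ((h1.add (h2.const_mul c)).add (h3.const_mul (c ^ 2))).sub (h4.const_mul c)

variable {R : Type*} [Ring R] {L : MilnorRep K R}

theorem isNormLike_cyclicNorm [Nontrivial E] {w : R} (h : L.IsNormLike w C.norm) {b : K}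
    (hb : b ≠ 0) : L.IsNormLike (w * L b) (C.cyclicNorm b) :=
  h.triple (T := C.trace) (S := C.quad) (e := 1) (m := fun x y z => x * y * z)
    (fun x y z => by
      apply C.algebraMap_inj
      simp only [algebraMap_norm, _root_.map_mul]
      ring)
    C.norm_smul_one_sub C.norm_smul C.trace_smul one_ne_zero (by simp) (by simp) hb

theorem isNormLike_titsNorm [Nontrivial E] {w : R} {b : K} (h : L.IsNormLike w (C.cyclicNorm b))
    {c : K} (hc : c ≠ 0) : L.IsNormLike (w * L c) (C.titsNorm b c) := by
  refine h.triple (T := fun z => C.trace z.1)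
    (S := fun z => C.quad z.1 - b * C.trace (z.2.2 * z.2.1))
    (e := (1, 0, 0)) (m := fun x y z => C.cyclicMul b (C.cyclicMul b x y) z)
    (fun x y z => by rw [cyclicNorm_mul, cyclicNorm_mul]) ?_ ?_
    (fun g z => C.trace_smul g z.1) (by simp) (by simp [cyclicMul]) (by simp [cyclicMul]) hc
  · rintro g ⟨x, y, z⟩
    have e : (-z) * (g • 1 - x) * (-y) = g • (z * y) + (-1 : K) • (z * x * y) := by
      simp only [Algebra.smul_def, map_neg, _root_.map_one]
      ring
    have n : ∀ z : E, C.norm (-z) = - C.norm z := fun z => by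
      rw [← neg_one_smul K, norm_smul]
      ring
    simp only [cyclicNorm, Prod.smul_mk, smul_zero, Prod.mk_sub_mk, zero_sub, e, n,
      norm_smul_one_sub, trace_add, trace_smul]
    ring
  · rintro g ⟨x, y, z⟩
    have e : (g • z) * (g • x) * (g • y) = (g ^ 3) • (z * x * y) := by
      simp only [Algebra.smul_def, map_pow]
      ring
    simp only [cyclicNorm, Prod.smul_mk, norm_smul, e, trace_smul]
    ring

end CyclicCubic

theorem exists_cyclicCubic_of_zeta {K : Type u} [Field K] {ζ : K} (hζ : ζ ^ 2 + ζ + 1 = 0) (a : K) :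
    ∃ (E : Type u) (_ : CommRing E) (_ : Nontrivial E) (_ : Algebra K E) (_ : Module.Finite K E)
      (C : CyclicCubic K E) (r : E ≃ₗ[K] (Fin 3 → K)), ∀ z, C.norm z =
        r z 0 ^ 3 + a * r z 1 ^ 3 + a ^ 2 * r z 2 ^ 3 - a * (3 * (r z 2 * r z 0 * r z 1)) := by
  have hmon : (Polynomial.X ^ 3 - Polynomial.C a).Monic :=
    Polynomial.monic_X_pow_sub_C a (by norm_num)
  have hdim : (AdjoinRoot.powerBasis' hmon).dim = 3 := by
    simp [AdjoinRoot.powerBasis'_dim]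
  have hdeg : (Polynomial.X ^ 3 - Polynomial.C a).degree ≠ 0 := by
    rw [Polynomial.degree_X_pow_sub_C (by norm_num)]
    norm_num
  set E := AdjoinRoot (Polynomial.X ^ 3 - Polynomial.C a) with hE
  set α : E := AdjoinRoot.root _ with hα
  have hα3 : α ^ 3 = algebraMap K E a := by
    have := AdjoinRoot.eval₂_root (Polynomial.X ^ 3 - Polynomial.C a)
    rw [Polynomial.eval₂_sub, Polynomial.eval₂_X_pow, Polynomial.eval₂_C] at this
    exact sub_eq_zero.1 this
  have hz : algebraMap K E ζ ^ 2 + algebraMap K E ζ + 1 = 0 := by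
    rw [← map_pow, ← map_add, ← map_one (algebraMap K E), ← map_add, hζ, map_zero]
  have hz3 : algebraMap K E ζ ^ 3 = 1 := by linear_combination (algebraMap K E ζ - 1) * hz
  let B : Module.Basis (Fin 3) K E := (AdjoinRoot.powerBasis' hmon).basis.reindex (finCongr hdim)
  have hB : ∀ i, B i = α ^ (i : ℕ) := fun i => by simp [B, hα]
  have hrep : ∀ z, z = algebraMap K E (B.equivFun z 0) + algebraMap K E (B.equivFun z 1) * α +
      algebraMap K E (B.equivFun z 2) * α ^ 2 := fun z => by
    nth_rewrite 1 [← B.sum_equivFun z]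
    simp [Fin.sum_univ_three, hB, Algebra.smul_def]
  have hnt : Nontrivial E := AdjoinRoot.nontrivial _ hdeg
  let σ : E →ₐ[K] E := AdjoinRoot.liftAlgHom _ (Algebra.ofId K E) (algebraMap K E ζ * α) (by
    rw [Polynomial.eval₂_sub, Polynomial.eval₂_X_pow, Polynomial.eval₂_C, mul_pow, hz3, one_mul,
      hα3]
    exact sub_self _)
  have hσα : σ α = algebraMap K E ζ * α := AdjoinRoot.liftAlgHom_root ..
  have hσ : ∀ x y w, σ (algebraMap K E x + algebraMap K E y * α + algebraMap K E w * α ^ 2) =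
      algebraMap K E x + algebraMap K E ζ * algebraMap K E y * α +
        algebraMap K E ζ ^ 2 * algebraMap K E w * α ^ 2 := fun x y w => by
    simp only [map_add, map_mul, map_pow, AlgHom.commutes, hσα]
    ring
  have hσ2 : ∀ x y w, σ (algebraMap K E x + algebraMap K E ζ * algebraMap K E y * α +
        algebraMap K E ζ ^ 2 * algebraMap K E w * α ^ 2) =
      algebraMap K E x + algebraMap K E ζ ^ 2 * algebraMap K E y * α +
        algebraMap K E ζ * algebraMap K E w * α ^ 2 := fun x y w => by
    simp only [map_add, map_mul, map_pow, AlgHom.commutes, hσα]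
    linear_combination (algebraMap K E ζ * algebraMap K E w * α ^ 2) * hz3
  have hσz : ∀ z, σ z = _ := fun z => (congrArg σ (hrep z)).trans (hσ _ _ _)
  have hσσz : ∀ z, σ (σ z) = _ := fun z => (congrArg σ (hσz z)).trans (hσ2 _ _ _)
  have hN : ∀ z, z * σ z * σ (σ z) = algebraMap K E (B.equivFun z 0 ^ 3 + a * B.equivFun z 1 ^ 3 +
      a ^ 2 * B.equivFun z 2 ^ 3 - a * (3 * (B.equivFun z 2 * B.equivFun z 0 * B.equivFun z 1))) :=
    fun z => by
      rw [hσσz, hσz]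
      nth_rewrite 1 [hrep z]
      simp only [map_add, map_sub, map_mul, map_pow, ← hα3, map_ofNat]
      set p := algebraMap K E (B.equivFun z 0)
      set q := algebraMap K E (B.equivFun z 1)
      set r := algebraMap K E (B.equivFun z 2)
      set θ := algebraMap K E ζ
      linear_combination (p + q * α + r * α ^ 2) * (((q * α) ^ 2 + (r * α ^ 2) ^ 2) * (θ - 1) +
        p * (q * α) + p * (r * α ^ 2) + (q * α) * (r * α ^ 2) * (θ ^ 2 - θ + 1)) * hz
  have hT : ∀ z, z + σ z + σ (σ z) = algebraMap K E (3 * B.equivFun z 0) := fun z => by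
    rw [hσσz, hσz]
    nth_rewrite 1 [hrep z]
    simp only [map_mul, map_ofNat]
    linear_combination (algebraMap K E (B.equivFun z 1) * α +
      algebraMap K E (B.equivFun z 2) * α ^ 2) * hz
  have hS : ∀ z, z * σ z + σ z * σ (σ z) + σ (σ z) * z = algebraMap K E (3 * B.equivFun z 0 ^ 2 -
      3 * a * (B.equivFun z 1 * B.equivFun z 2)) := fun z => by
    have e : z * σ z + σ z * σ (σ z) + σ (σ z) * z = z * (σ z + σ (σ z)) + σ z * σ (σ z) := by ring
    rw [e, hσσz, hσz]
    nth_rewrite 1 [hrep z]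
    simp only [map_sub, map_mul, map_pow, ← hα3, map_ofNat]
    set p := algebraMap K E (B.equivFun z 0)
    set q := algebraMap K E (B.equivFun z 1)
    set r := algebraMap K E (B.equivFun z 2)
    set θ := algebraMap K E ζ
    linear_combination ((p + q * α + r * α ^ 2) * (q * α + r * α ^ 2) +
        (((q * α) ^ 2 + (r * α ^ 2) ^ 2) * (θ - 1) +
        p * (q * α) + p * (r * α ^ 2) + (q * α) * (r * α ^ 2) * (θ ^ 2 - θ + 1))) * hz
  have ht : ∀ k, B.coord 0 (algebraMap K E k) = k := fun k => by
    have : algebraMap K E k = k • B 0 := by rw [hB, Algebra.smul_def]; simp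
    simp [this]
  let C : CyclicCubic K E :=
    { σ := σ
      t := B.coord 0
      σ_cube := fun z => by
        rw [hσσz z]
        conv_rhs => rw [hrep z]
        simp only [map_add, map_mul, map_pow, AlgHom.commutes, hσα]
        linear_combination (algebraMap K E (B.equivFun z 1) * α +
          algebraMap K E (B.equivFun z 2) * α ^ 2) * hz3
      t_algebraMap := ht
      norm_mem := fun z => by rw [hN, ht]
      trace_mem := fun z => by rw [hT, ht]
      quad_mem := fun z => by rw [hS, ht] }
  refine ⟨E, inferInstance, hnt, inferInstance, Module.Finite.of_basis B, C, B.equivFun,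
    fun z => ?_⟩
  apply C.algebraMap_inj
  rw [C.algebraMap_norm]
  exact hN z

theorem MilnorRep.isNormLike_cube {K : Type*} [Field K] {R : Type*} [Ring R] (L : MilnorRep K R) :
    L.IsNormLike 1 (fun x : K => x ^ 3) := by
  refine ⟨fun z hz => ?_, fun z hz h => absurd (pow_eq_zero_iff (by norm_num) |>.1 h) hz⟩
  rw [one_mul, L.map_cube (fun h => hz (by simp [h]))]

theorem CyclicCubic.isNormLike_norm {K E : Type*} [Field K] [CommRing E] [Algebra K E]
    {R : Type*} [Ring R] {L : MilnorRep K R} (C : CyclicCubic K E) {a : K} (ha : a ≠ 0)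
    (r : E ≃ₗ[K] (Fin 3 → K)) (h : ∀ z, C.norm z =
      r z 0 ^ 3 + a * r z 1 ^ 3 + a ^ 2 * r z 2 ^ 3 - a * (3 * (r z 2 * r z 0 * r z 1))) :
    L.IsNormLike (L a) C.norm := by
  have H := L.isNormLike_cube.triple (T := fun x => 3 * x) (S := fun x => 3 * x ^ 2) (e := 1)
    (m := fun x y z => x * y * z) (fun x y z => by ring)
    (fun g z => by simp only [smul_eq_mul]; ring)
    (fun g z => by simp only [smul_eq_mul]; ring) (fun g z => by simp only [smul_eq_mul]; ring)
    one_ne_zero (by simp) (by simp) ha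
  rw [one_mul] at H
  refine ⟨fun z hz => ?_, fun z hz h0 => H.2 (r z 0, r z 1, r z 2) (fun h' => hz ?_) ?_⟩
  · rw [h] at hz ⊢
    exact H.1 (r z 0, r z 1, r z 2) hz
  · simp only [Prod.mk_eq_zero] at h'
    apply r.injective
    ext i
    fin_cases i <;> simp [h']
  · rw [← h0, h]

/-- Every cubic homogeneous polynomial in more than `81` variables has a nontrivial zero. -/
def CubicsIsotropic (K : Type*) [Field K] : Prop :=
  ∀ N : ℕ, 81 < N → ∀ f : MvPolynomial (Fin N) K, f.IsHomogeneous 3 →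
    ∃ x : Fin N → K, x ≠ 0 ∧ MvPolynomial.eval x f = 0

theorem IsCubicForm.exists_zero {K : Type*} [Field K] (hK : CubicsIsotropic K) {V : Type*}
    [AddCommGroup V] [Module K V] [Module.Finite K V] (hV : 81 < Module.finrank K V) {f : V → K}
    (hf : IsCubicForm K f) : ∃ v, v ≠ 0 ∧ f v = 0 := by
  obtain ⟨g, h1, h2, h3, h4⟩ := hf
  let b := Module.finBasis K V
  let p : MvPolynomial (Fin (Module.finrank K V)) K :=
    ∑ i, ∑ j, ∑ k, MvPolynomial.C (g (b i) (b j) (b k)) *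
      (MvPolynomial.X i * MvPolynomial.X j * MvPolynomial.X k)
  have hp : p.IsHomogeneous 3 := by
    refine MvPolynomial.IsHomogeneous.sum _ _ _ fun i _ =>
      MvPolynomial.IsHomogeneous.sum _ _ _ fun j _ =>
      MvPolynomial.IsHomogeneous.sum _ _ _ fun k _ => ?_
    exact MvPolynomial.IsHomogeneous.C_mul
      (((MvPolynomial.isHomogeneous_X K i).mul (MvPolynomial.isHomogeneous_X K j)).mul
        (MvPolynomial.isHomogeneous_X K k)) _
  obtain ⟨x, hx, hx0⟩ := hK _ hV p hp
  refine ⟨b.equivFun.symm x, (map_ne_zero_iff _ b.equivFun.symm.injective).2 hx, ?_⟩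
  rw [h4, ← hx0]
  have e1 : ∀ u w, g u w (b.equivFun.symm x) = ∑ k, x k * g u w (b k) := fun u w => by
    rw [b.equivFun_symm_apply]
    exact (map_sum (h1 u w).mk' _ _).trans
      (Finset.sum_congr rfl fun k _ => map_smul (h1 u w).mk' _ _)
  have e2 : ∀ u w, g u (b.equivFun.symm x) w = ∑ k, x k * g u (b k) w := fun u w => by
    rw [b.equivFun_symm_apply]
    exact (map_sum (h2 u w).mk' _ _).trans
      (Finset.sum_congr rfl fun k _ => map_smul (h2 u w).mk' _ _)
  have e3 : ∀ u w, g (b.equivFun.symm x) u w = ∑ k, x k * g (b k) u w := fun u w => by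
    rw [b.equivFun_symm_apply]
    exact (map_sum (h3 u w).mk' _ _).trans
      (Finset.sum_congr rfl fun k _ => map_smul (h3 u w).mk' _ _)
  rw [e3]
  simp only [e2, e1, p, map_sum, _root_.map_mul, MvPolynomial.eval_C, MvPolynomial.eval_X,
    Finset.mul_sum]
  refine Finset.sum_congr rfl fun i _ => Finset.sum_congr rfl fun j _ =>
    Finset.sum_congr rfl fun k _ => by ring

/-- Products of five elements vanish in the Milnor ring modulo `3`. -/
def KillsFive (K : Type u) [Field K] : Prop :=
  ∀ (R : Type u) [Ring R] (L : MilnorRep K R) (a b c d e : K), a ≠ 0 → b ≠ 0 → c ≠ 0 → d ≠ 0 →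
    e ≠ 0 → L a * L b * L c * L d * L e = 0

theorem killsFive_of_zeta {K : Type u} [Field K] (hK : CubicsIsotropic K) {ζ : K}
    (hζ : ζ ^ 2 + ζ + 1 = 0) : KillsFive K := by
  intro R _ L a b c d e ha hb hc hd he
  obtain ⟨E, _, _, _, _, C, r, hr⟩ := exists_cyclicCubic_of_zeta hζ a
  have H := ((C.isNormLike_titsNorm (C.isNormLike_cyclicNorm (C.isNormLike_norm (L := L) ha r hr)
    hb) hc).double hd).double he
  have hE : Module.finrank K E = 3 := by rw [r.finrank_eq]; simp
  let A := (E × E × E) × (E × E × E) × (E × E × E)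
  have hA := C.isCubicForm_titsNorm b c
  have hA2 := (hA.comp (LinearMap.fst K A A)).add ((hA.comp (LinearMap.snd K A A)).const_mul d)
  have hA4 := (hA2.comp (LinearMap.fst K (A × A) (A × A))).add
    ((hA2.comp (LinearMap.snd K (A × A) (A × A))).const_mul e)
  obtain ⟨v, hv, hv0⟩ := hA4.exists_zero hK (by simp [A, Module.finrank_prod, hE])
  exact H.2 v hv hv0

section Symbols

variable {K : Type u} [Field K]

/-- Families of symbols on lists of units, with values in a `3`-torsion group, which are
multilinear and satisfy the Steinberg relation. -/
def symbolFamilies (K G : Type u) [Field K] [AddCommGroup G] : AddSubgroup (List Kˣ → G) where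
  carrier := {ψ | (∀ l, 3 • ψ l = 0) ∧
    (∀ l₁ l₂ : List Kˣ, ∀ u v : Kˣ,
      ψ (l₁ ++ (u * v) :: l₂) = ψ (l₁ ++ u :: l₂) + ψ (l₁ ++ v :: l₂)) ∧
    ∀ l₁ l₂ : List Kˣ, ∀ u v : Kˣ, (u : K) + v = 1 → ψ (l₁ ++ u :: v :: l₂) = 0}
  add_mem' := by
    rintro ψ χ ⟨h1, h2, h3⟩ ⟨h1', h2', h3'⟩
    refine ⟨fun l => ?_, fun l₁ l₂ u v => ?_, fun l₁ l₂ u v h => ?_⟩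
    · rw [Pi.add_apply, smul_add, h1, h1', add_zero]
    · simp only [Pi.add_apply, h2, h2']
      abel
    · rw [Pi.add_apply, h3 _ _ _ _ h, h3' _ _ _ _ h, add_zero]
  zero_mem' := by simp
  neg_mem' := by
    rintro ψ ⟨h1, h2, h3⟩
    refine ⟨fun l => ?_, fun l₁ l₂ u v => ?_, fun l₁ l₂ u v h => ?_⟩
    · rw [Pi.neg_apply, smul_neg, h1, neg_zero]
    · simp only [Pi.neg_apply, h2]
      abel
    · rw [Pi.neg_apply, h3 _ _ _ _ h, neg_zero]

variable {G : Type u} [AddCommGroup G]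

/-- Insertion of a unit at the front. -/
def symbolCons (u : Kˣ) : AddMonoid.End (symbolFamilies K G) where
  toFun ψ := ⟨fun l => ψ.1 (u :: l), fun _ => ψ.2.1 _, fun l₁ l₂ => ψ.2.2.1 (u :: l₁) l₂,
    fun l₁ l₂ => ψ.2.2.2 (u :: l₁) l₂⟩
  map_zero' := rfl
  map_add' _ _ := rfl

open Classical in
/-- The representation of the Milnor ring on families of symbols. -/
noncomputable def symbolRep (K G : Type u) [Field K] [AddCommGroup G] :
    MilnorRep K (AddMonoid.End (symbolFamilies K G)) where
  toFun x := if h : x = 0 then 0 else symbolCons (Units.mk0 x h)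
  map_mul' x y hx hy := by
    rw [dif_neg hx, dif_neg hy, dif_neg (mul_ne_zero hx hy), Units.mk0_mul x y]
    ext ψ l
    exact ψ.2.2.1 [] l _ _
  steinberg' x y hx hy h := by
    rw [dif_neg hx, dif_neg hy]
    ext ψ l
    exact ψ.2.2.2 [] l (Units.mk0 y hy) (Units.mk0 x hx) (by simpa [add_comm] using h)
  three := by
    ext ψ l
    have : ((3 : AddMonoid.End (symbolFamilies K G)) ψ) = 3 • ψ := rfl
    rw [this]
    exact ψ.2.1 l

theorem KillsFive.symbolFamilies_eq_zero (hK : KillsFive K) {ψ : List Kˣ → G}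
    (hψ : ψ ∈ symbolFamilies K G) (a b c d e : Kˣ) : ψ [a, b, c, d, e] = 0 := by
  have h := hK _ (symbolRep K G) e d c b a e.ne_zero d.ne_zero c.ne_zero b.ne_zero a.ne_zero
  have hu : ∀ u : Kˣ, (symbolRep K G) u = symbolCons u := fun u => by simp [symbolRep]
  simp only [hu] at h
  exact congrFun (congrArg Subtype.val (DFunLike.congr_fun h ⟨ψ, hψ⟩)) []

theorem getD_append_cons {α : Type*} (l₁ l₂ : List α) (u d : α) (j : ℕ) :
    (l₁ ++ u :: l₂).getD j d = if j < l₁.length then l₁.getD j d else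
      if j = l₁.length then u else l₂.getD (j - l₁.length - 1) d := by
  split_ifs with h1 h2
  · rw [List.getD_append _ _ _ _ h1]
  · rw [List.getD_append_right _ _ _ _ (not_lt.1 h1), h2]
    simp
  · rw [List.getD_append_right _ _ _ _ (not_lt.1 h1)]
    obtain ⟨k, hk⟩ := Nat.exists_eq_add_of_lt (lt_of_le_of_ne (not_lt.1 h1) (Ne.symm h2))
    subst hk
    simp [show l₁.length + k + 1 - l₁.length = k + 1 by omega]

open Classical in
/-- The symbols of `kMod K p n` as a function on lists of units. -/
noncomputable def listSymbol (K : Type u) [Field K] (p n : ℕ) (l : List Kˣ) : kMod K p n :=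
  if l.length = n then symbol K p (fun i : Fin n => l.getD i 1) else 0

theorem smul_kMod (p n : ℕ) (α : kMod K p n) : p • α = 0 := by
  obtain ⟨β, rfl⟩ := QuotientAddGroup.mk_surjective α
  exact (QuotientAddGroup.eq_zero_iff (p • β)).2 (AddSubgroup.subset_closure ⟨β, rfl⟩)

theorem mk_mk_eq_zero (p n : ℕ) {z : FreeAbelianGroup (Fin n → Kˣ)} (hz : z ∈ milnorRel K n) :
    (QuotientAddGroup.mk (QuotientAddGroup.mk z : MilnorK K n) : kMod K p n) = 0 := by
  have : (QuotientAddGroup.mk z : MilnorK K n) = 0 := (QuotientAddGroup.eq_zero_iff z).2 hz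
  rw [this]
  rfl

theorem listSymbol_mem (n : ℕ) : listSymbol K 3 n ∈ symbolFamilies K (kMod K 3 n) := by
  refine ⟨fun l => smul_kMod 3 n _, fun l₁ l₂ u v => ?_, fun l₁ l₂ u v h => ?_⟩
  · simp only [listSymbol, List.length_append, List.length_cons]
    split_ifs with hl
    · let i : Fin n := ⟨l₁.length, by omega⟩
      have hupd : ∀ w, (fun j : Fin n => (l₁ ++ w :: l₂).getD j 1) =
          Function.update (fun j : Fin n => (l₁ ++ (u * v) :: l₂).getD j 1) i w := fun w => by
        ext1 j
        rcases eq_or_ne j i with rfl | hj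
        · simp [i]
        · have : (j : ℕ) ≠ l₁.length := fun h => hj (Fin.ext h)
          rw [Function.update_of_ne hj]
          simp only [getD_append_cons, if_neg this]
      have hz := mk_mk_eq_zero 3 n (K := K) (z := _) (AddSubgroup.subset_closure (Or.inl
        ⟨fun j : Fin n => (l₁ ++ (u * v) :: l₂).getD j 1, i, u, v,
          by simp [i], rfl⟩))
      rw [hupd u, hupd v]
      have hz' : symbol K 3 (fun j : Fin n => (l₁ ++ (u * v) :: l₂).getD j 1) -
        symbol K 3 (Function.update (fun j : Fin n => (l₁ ++ (u * v) :: l₂).getD j 1) i u) -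
        symbol K 3 (Function.update (fun j : Fin n => (l₁ ++ (u * v) :: l₂).getD j 1) i v) = 0 := hz
      rw [sub_sub, sub_eq_zero] at hz'
      exact hz'
    · rw [add_zero]
  · simp only [listSymbol, List.length_append, List.length_cons]
    split_ifs with hl
    · refine mk_mk_eq_zero 3 n (AddSubgroup.subset_closure (Or.inr
        ⟨_, ⟨l₁.length, by omega⟩, ⟨l₁.length + 1, by omega⟩, rfl, ?_, rfl⟩))
      simpa [getD_append_cons] using h
    · rfl

theorem KillsFive.kMod_eq_zero (hK : KillsFive K) (α : kMod K 3 5) : α = 0 := by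
  have hs : ∀ a : Fin 5 → Kˣ, symbol K 3 a = 0 := fun a => by
    rw [← hK.symbolFamilies_eq_zero (listSymbol_mem 5) (a 0) (a 1) (a 2) (a 3) (a 4), listSymbol,
      if_pos (by simp)]
    congr 1
    ext1 i
    fin_cases i <;> rfl
  obtain ⟨β, rfl⟩ := QuotientAddGroup.mk_surjective α
  obtain ⟨z, rfl⟩ := QuotientAddGroup.mk_surjective β
  let q : FreeAbelianGroup (Fin 5 → Kˣ) →+ kMod K 3 5 :=
    (QuotientAddGroup.mk' (pMul K 3 5)).comp (QuotientAddGroup.mk' (milnorRel K 5))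
  have : q = 0 := FreeAbelianGroup.lift_ext q 0 fun a => hs a
  exact DFunLike.congr_fun this z

end Symbols

/-- An extension obtained by adjoining a primitive cube root of unity `θ` not in the base field. -/
structure IsEisenstein {k K : Type*} [Field k] [Field K] [Algebra k K] (θ : K) : Prop where
  root : θ ^ 2 + θ + 1 = 0
  exists_rep : ∀ x : K, ∃ f g : k, x = algebraMap k K f + algebraMap k K g * θ
  irreducible : ∀ f : k, f ^ 2 + f + 1 ≠ 0

theorem exists_isEisenstein {k : Type u} [Field k] (hk : ∀ f : k, f ^ 2 + f + 1 ≠ 0) :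
    ∃ (K : Type u) (_ : Field K) (_ : Algebra k K) (θ : K), IsEisenstein (k := k) θ := by
  let p : Polynomial k := Polynomial.X ^ 2 + Polynomial.X + 1
  have hdeg : p.natDegree = 2 := by simp only [p]; compute_degree!
  have hmon : p.Monic := by simp only [p]; monicity!
  have hp : Irreducible p := by
    rw [Polynomial.irreducible_iff_roots_eq_zero_of_degree_le_three (by omega) (by omega)]
    refine Multiset.eq_zero_of_forall_notMem fun f hf => hk f ?_
    simpa [p] using (Polynomial.mem_roots'.1 hf).2
  have := Fact.mk hp
  refine ⟨AdjoinRoot p, inferInstance, inferInstance, AdjoinRoot.root p, ?_, fun x => ?_, hk⟩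
  · have := AdjoinRoot.eval₂_root p
    simpa [p] using this
  · obtain ⟨q, rfl⟩ := AdjoinRoot.mk_surjective x
    have h1 : AdjoinRoot.mk p q = AdjoinRoot.mk p (q %ₘ p) := by
      rw [AdjoinRoot.mk_eq_mk]
      exact ⟨q /ₘ p, by rw [sub_eq_iff_eq_add, add_comm, Polynomial.modByMonic_add_div]⟩
    have h2 : (q %ₘ p).natDegree ≤ 1 := by
      have := Polynomial.natDegree_modByMonic_lt q hmon (by intro h; simp [h] at hdeg)
      omega
    obtain ⟨b, a, h⟩ := Polynomial.exists_eq_X_add_C_of_natDegree_le_one h2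
    refine ⟨a, b, ?_⟩
    rw [h1, h, map_add, map_mul, AdjoinRoot.mk_X, AdjoinRoot.mk_C, AdjoinRoot.mk_C, add_comm]
    rfl

namespace IsEisenstein

variable {k K : Type*} [Field k] [Field K] [Algebra k K] {θ : K}

theorem norm_ne_zero (h : IsEisenstein (k := k) θ) {f g : k} (hfg : f ^ 2 - f * g + g ^ 2 = 0) :
    f = 0 ∧ g = 0 := by
  have hg : g = 0 := by
    by_contra hg
    apply h.irreducible (-f / g)
    field_simp
    linear_combination hfg
  subst hg
  simpa using hfg

theorem rep_eq_zero (h : IsEisenstein (k := k) θ) {f g : k}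
    (hfg : algebraMap k K f + algebraMap k K g * θ = 0) : f = 0 ∧ g = 0 := by
  apply h.norm_ne_zero
  apply (algebraMap k K).injective
  simp only [map_add, map_sub, map_mul, map_pow, map_zero]
  linear_combination (algebraMap k K f - algebraMap k K g * (1 + θ)) * hfg +
    algebraMap k K g ^ 2 * h.root

theorem exists_polynomial_rep (h : IsEisenstein (k := k) θ) {ι : Type*} {n : ℕ}
    {q : MvPolynomial ι K} (hq : q.IsHomogeneous n) :
    ∃ q₀ q₁ : MvPolynomial ι k, q₀.IsHomogeneous n ∧ q₁.IsHomogeneous n ∧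
      q = MvPolynomial.map (algebraMap k K) q₀ +
        MvPolynomial.map (algebraMap k K) q₁ * MvPolynomial.C θ := by
  choose f g hfg using h.exists_rep
  have hom : ∀ f : K → k,
      (∑ m ∈ q.support, MvPolynomial.monomial m (f (q.coeff m))).IsHomogeneous n :=
    fun f => MvPolynomial.IsHomogeneous.sum _ _ _ fun m hm =>
      MvPolynomial.isHomogeneous_monomial _ (by
        have := hq (MvPolynomial.mem_support_iff.1 hm)
        rwa [Finsupp.degree_eq_weight_one])
  refine ⟨_, _, hom f, hom g, ?_⟩
  conv_lhs => rw [q.as_sum]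
  simp only [map_sum, MvPolynomial.map_monomial, Finset.sum_mul, ← Finset.sum_add_distrib]
  refine Finset.sum_congr rfl fun m _ => ?_
  rw [mul_comm, MvPolynomial.C_mul_monomial, ← map_add, mul_comm θ, ← hfg]

end IsEisenstein

theorem exists_anisotropic_iterate {K : Type u} [Field K] {N : ℕ} {p : MvPolynomial (Fin N) K}
    (hp : p.IsHomogeneous 3) (hp0 : ∀ x, MvPolynomial.eval x p = 0 → x = 0) (n : ℕ) :
    ∃ (ι : Type) (_ : Fintype ι) (q : MvPolynomial ι K), Fintype.card ι = N ^ n ∧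
      q.IsHomogeneous (3 ^ n) ∧ ∀ x, MvPolynomial.eval x q = 0 → x = 0 := by
  induction n with
  | zero =>
    refine ⟨Unit, inferInstance, MvPolynomial.X (), by simp,
      by simpa using MvPolynomial.isHomogeneous_X K (), fun x hx => ?_⟩
    ext i
    simpa using hx
  | succ n ih =>
    obtain ⟨ι, _, q, hcard, hq, hq0⟩ := ih
    refine ⟨Fin N × ι, inferInstance,
      MvPolynomial.bind₁ (fun i => MvPolynomial.rename (Prod.mk i) q) p, ?_, ?_, fun x hx => ?_⟩
    · rw [Fintype.card_prod, hcard, Fintype.card_fin, pow_succ']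
    · rw [pow_succ]
      exact hp.aeval _ fun i => hq.rename_isHomogeneous
    · rw [← MvPolynomial.aeval_eq_eval, MvPolynomial.aeval_bind₁, MvPolynomial.aeval_eq_eval] at hx
      have h1 := hp0 _ hx
      ext ⟨i, j⟩
      have h2 := congrFun h1 i
      rw [MvPolynomial.aeval_rename, MvPolynomial.aeval_eq_eval] at h2
      exact congrFun (hq0 _ h2) j

theorem IsCField.cubicsIsotropic_self {k : Type u} [Field k] (hk : IsCField k 4) :
    CubicsIsotropic k := fun N hN f hf => hk 3 N (by norm_num) (by norm_num; exact hN) f hf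

theorem IsCField.cubicsIsotropic {k K : Type u} [Field k] [Field K] [Algebra k K]
    (hk : IsCField k 4) {θ : K} (hθ : IsEisenstein (k := k) θ) : CubicsIsotropic K := by
  intro N hN p hp
  by_contra! hp0
  have hp0 : ∀ x, MvPolynomial.eval x p = 0 → x = 0 := fun x hx => by
    by_contra h
    exact hp0 x h hx
  obtain ⟨n, hn⟩ : ∃ n : ℕ, 8 * 81 ^ n < N ^ n := by
    obtain ⟨n, hn⟩ := pow_unbounded_of_one_lt (8 : ℚ) (show (1 : ℚ) < N / 81 by
      rw [lt_div_iff₀ (by norm_num)]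
      exact_mod_cast hN)
    refine ⟨n, ?_⟩
    rw [div_pow, lt_div_iff₀ (by positivity)] at hn
    exact_mod_cast hn
  obtain ⟨ι, _, q, hcard, hq, hq0⟩ := exists_anisotropic_iterate hp hp0 n
  let s : MvPolynomial (ι × Fin 2) K := MvPolynomial.bind₁
    (fun i => MvPolynomial.X (i, 0) + MvPolynomial.C θ * MvPolynomial.X (i, 1)) q
  have hs : s.IsHomogeneous (3 ^ n) := by
    have := hq.aeval (n := 1)
      (fun i => MvPolynomial.X (i, (0 : Fin 2)) + MvPolynomial.C θ * MvPolynomial.X (i, 1)) fun i =>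
        (MvPolynomial.isHomogeneous_X K _).add ((MvPolynomial.isHomogeneous_X K _).C_mul θ)
    rwa [one_mul] at this
  obtain ⟨q₀, q₁, h₀, h₁, hs'⟩ := hθ.exists_polynomial_rep hs
  let e := Fintype.equivFin (ι × Fin 2)
  let P : MvPolynomial (ι × Fin 2) k := q₀ ^ 2 - q₀ * q₁ + q₁ ^ 2
  have hP : P.IsHomogeneous (2 * 3 ^ n) := by
    rw [mul_comm]
    refine ((h₀.pow 2).sub ?_).add (h₁.pow 2)
    rw [mul_two]
    exact h₀.mul h₁
  obtain ⟨x, hx, hx0⟩ := hk (2 * 3 ^ n) _ (by positivity) (by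
    rw [Fintype.card_prod, hcard, Fintype.card_fin]
    have : (2 * 3 ^ n) ^ 4 = 16 * 81 ^ n := by
      rw [mul_pow, ← pow_mul, mul_comm n 4, pow_mul]
      norm_num
    omega) (MvPolynomial.rename e P) hP.rename_isHomogeneous
  rw [MvPolynomial.eval_rename] at hx0
  simp only [P, map_add, map_sub, map_mul, map_pow] at hx0
  obtain ⟨z₀, z₁⟩ := hθ.norm_ne_zero hx0
  let y : ι × Fin 2 → k := x ∘ e
  have hsy : MvPolynomial.eval (fun i => algebraMap k K (y i)) s = 0 := by
    have ev : ∀ r : MvPolynomial (ι × Fin 2) k, MvPolynomial.eval (fun i => algebraMap k K (y i))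
        (MvPolynomial.map (algebraMap k K) r) =
          algebraMap k K (MvPolynomial.eval y r) := fun r => by
      exact (MvPolynomial.eval_map _ _ _).trans
        (MvPolynomial.eval₂_comp_left (algebraMap k K) (RingHom.id k) y r).symm
    rw [hs', map_add, map_mul, ev, ev, z₀, z₁]
    simp
  rw [← MvPolynomial.aeval_eq_eval, MvPolynomial.aeval_bind₁, MvPolynomial.aeval_eq_eval] at hsy
  have h1 := hq0 _ hsy
  apply hx
  have hy : ∀ i, y i = 0 := by
    rintro ⟨i, j⟩
    have h2 := congrFun h1 i
    simp only [map_add, MvPolynomial.aeval_X, map_mul, Pi.zero_apply] at h2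
    have h3 := hθ.rep_eq_zero (f := y (i, 0)) (g := y (i, 1)) (by
      rw [← h2]
      simp [mul_comm])
    fin_cases j
    exacts [h3.1, h3.2]
  ext j
  simpa [y] using hy (e.symm j)

theorem HahnSeries.order_leadingCoeff_of_add_eq_one {k : Type*} [Field k] {x y : LaurentSeries k}
    (hx : x ≠ 0) (hy : y ≠ 0) (h : x + y = 1) :
    (y.order = 0 ∧ y.leadingCoeff = 1) ∨ (x.order = 0 ∧ x.leadingCoeff = 1) ∨
      (x.order = 0 ∧ y.order = 0 ∧ x.leadingCoeff + y.leadingCoeff = 1) ∨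
      (y.order = x.order ∧ y.leadingCoeff = -x.leadingCoeff) := by
  have hc : ∀ i, x.coeff i + y.coeff i = if i = 0 then 1 else 0 := fun i => by
    rw [← HahnSeries.coeff_add, h, HahnSeries.coeff_one]
    split_ifs <;> rfl
  have hx0 : ∀ i, i < x.order → x.coeff i = 0 := fun i => HahnSeries.coeff_eq_zero_of_lt_order
  have hy0 : ∀ i, i < y.order → y.coeff i = 0 := fun i => HahnSeries.coeff_eq_zero_of_lt_order
  have hx1 := HahnSeries.coeff_order_eq_zero.not.2 hx
  have hy1 := HahnSeries.coeff_order_eq_zero.not.2 hy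
  simp only [HahnSeries.leadingCoeff_eq]
  generalize x.order = n at *
  generalize y.order = m at *
  have hn := hc n
  have hm := hc m
  have h0 := hc 0
  rcases lt_trichotomy n m with h | rfl | h <;> grind

/-- The representation of the Milnor ring of the field of Laurent series defined by the leading
coefficient and the order. -/
noncomputable def MilnorRep.laurent {k R : Type*} [Field k] [Ring R] (L : MilnorRep k R) :
    MilnorRep (LaurentSeries k) (Matrix (Fin 2) (Fin 2) R) where
  toFun x := !![L x.leadingCoeff, (x.order : R); 0, -L x.leadingCoeff]
  map_mul' x y hx hy := by
    rw [HahnSeries.leadingCoeff_mul, HahnSeries.order_mul hx hy,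
      L.map_mul (HahnSeries.leadingCoeff_ne_zero.2 hx) (HahnSeries.leadingCoeff_ne_zero.2 hy)]
    ext i j
    fin_cases i <;> fin_cases j <;> simp [add_comm]
  steinberg' x y hx hy h := by
    have hx1 := HahnSeries.leadingCoeff_ne_zero.2 hx
    have hy1 := HahnSeries.leadingCoeff_ne_zero.2 hy
    have e : !![L x.leadingCoeff, (x.order : R); 0, -L x.leadingCoeff] *
        !![L y.leadingCoeff, (y.order : R); 0, -L y.leadingCoeff] =
        !![L x.leadingCoeff * L y.leadingCoeff,
          L x.leadingCoeff * y.order - x.order * L y.leadingCoeff; 0,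
          L x.leadingCoeff * L y.leadingCoeff] := by
      ext i j
      fin_cases i <;> fin_cases j <;> simp [Matrix.mul_apply, Fin.sum_univ_two, sub_eq_add_neg]
    have z : (0 : Matrix (Fin 2) (Fin 2) R) = !![0, 0; 0, 0] := by
      ext i j
      fin_cases i <;> fin_cases j <;> rfl
    rw [e, z]
    rcases HahnSeries.order_leadingCoeff_of_add_eq_one hx hy h with
      ⟨h1, h2⟩ | ⟨h1, h2⟩ | ⟨h1, h2, h3⟩ | ⟨h1, h2⟩
    · simp [h1, h2, L.map_one]
    · simp [h1, h2, L.map_one]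
    · simp [h1, h2, L.steinberg hx1 hy1 h3]
    · rw [h1, h2, L.map_neg hx1, L.mul_self hx1, Int.cast_comm, sub_self]
  three := by rw [← map_ofNat (Matrix.scalar (Fin 2)) 3, L.three, map_zero]

section

variable {k K M S : Type u} [Field k] [Field K] [Algebra k K] [Field M] [Algebra k M] [Ring S]

/-- The pullback of a representation along a homomorphism of fields. -/
def MilnorRep.comp (Λ : MilnorRep M S) (g : k →+* M) : MilnorRep k S where
  toFun x := Λ (g x)
  map_mul' x y hx hy := by
    rw [_root_.map_mul, Λ.map_mul ((map_ne_zero g).2 hx) ((map_ne_zero g).2 hy)]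
  steinberg' x y hx hy h := Λ.steinberg ((map_ne_zero g).2 hx) ((map_ne_zero g).2 hy) (by
    rw [← map_add, h, _root_.map_one])
  three := Λ.three

/-- The product of a family of representations. -/
def MilnorRep.pi {ι : Type*} {S : ι → Type*} [∀ i, Ring (S i)] (Λ : ∀ i, MilnorRep M (S i)) :
    MilnorRep M (∀ i, S i) where
  toFun x i := Λ i x
  map_mul' _ _ hx hy := funext fun i => (Λ i).map_mul hx hy
  steinberg' _ _ hx hy h := funext fun i => (Λ i).steinberg hx hy h
  three := funext fun i => (Λ i).three

variable (Λ : MilnorRep M S) (X : M) (D : Subring S)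

/-- The additive subgroup spanned by the products of at most one linear polynomial symbol and
a coefficient in `D`. -/
def linearSpan (k : Type u) {M S : Type u} [Field k] [Field M] [Algebra k M] [Ring S]
    (Λ : MilnorRep M S) (X : M) (D : Subring S) : AddSubgroup S :=
  AddSubgroup.closure {s | s ∈ D ∨ ∃ r : k, ∃ d ∈ D, s = Λ (X - algebraMap k M r) * d}

variable {Λ X D}

theorem mul_mem_linearSpan (hX : ∀ f : k, X - algebraMap k M f ≠ 0)
    (hD : ∀ f : k, f ≠ 0 → Λ (algebraMap k M f) ∈ D) {f g : k} (hfg : f ≠ 0 ∨ g ≠ 0) {s : S}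
    (hs : s ∈ linearSpan k Λ X D) :
    Λ (algebraMap k M f + algebraMap k M g * X) * s ∈ linearSpan k Λ X D := by
  have hinj : ∀ f : k, f ≠ 0 → algebraMap k M f ≠ 0 := fun f hf => (map_ne_zero _).2 hf
  have mem1 : ∀ d ∈ D, d ∈ linearSpan k Λ X D := fun d hd =>
    AddSubgroup.subset_closure (Or.inl hd)
  have mem2 : ∀ r : k, ∀ d ∈ D, Λ (X - algebraMap k M r) * d ∈ linearSpan k Λ X D :=
    fun r d hd => AddSubgroup.subset_closure (Or.inr ⟨r, d, hd, rfl⟩)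
  have const : ∀ f : k, f ≠ 0 → ∀ s ∈ linearSpan k Λ X D,
      Λ (algebraMap k M f) * s ∈ linearSpan k Λ X D := by
    intro f hf s hs
    induction hs using AddSubgroup.closure_induction with
    | mem s hs =>
      rcases hs with hs | ⟨r, d, hd, rfl⟩
      · exact mem1 _ (D.mul_mem (hD f hf) hs)
      · rw [← mul_assoc, Λ.anticomm (hinj f hf) (hX r), neg_mul, mul_assoc]
        exact neg_mem (mem2 r _ (D.mul_mem (hD f hf) hd))
    | zero => rw [mul_zero]; exact zero_mem _
    | add s t _ _ hs ht => rw [mul_add]; exact add_mem hs ht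
    | neg s _ hs => rw [mul_neg]; exact neg_mem hs
  have lin : ∀ r : k, ∀ s ∈ linearSpan k Λ X D,
      Λ (X - algebraMap k M r) * s ∈ linearSpan k Λ X D := by
    intro r s hs
    induction hs using AddSubgroup.closure_induction with
    | mem s hs =>
      rcases hs with hs | ⟨t, d, hd, rfl⟩
      · exact mem2 r s hs
      · by_cases hrt : r = t
        · rw [hrt, ← mul_assoc, Λ.mul_self (hX t), zero_mul]
          exact zero_mem _
        have hc : t - r ≠ 0 := sub_ne_zero.2 (Ne.symm hrt)
        have hc' := hinj _ hc
        have st := Λ.steinberg (div_ne_zero (hX r) hc') (neg_ne_zero.2 (div_ne_zero (hX t) hc')) (by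
          rw [← sub_eq_add_neg, ← sub_div, div_eq_one_iff_eq hc', map_sub]
          ring)
        rw [Λ.map_neg (div_ne_zero (hX t) hc'), Λ.map_div (hX r) hc', Λ.map_div (hX t) hc', sub_mul,
          mul_sub, mul_sub, Λ.mul_self hc', sub_zero, Λ.anticomm hc' (hX t), sub_neg_eq_add,
          sub_add, sub_eq_zero] at st
        rw [← mul_assoc, st, sub_mul, mul_assoc, mul_assoc]
        exact sub_mem (mem2 r _ (D.mul_mem (hD _ hc) hd)) (mem2 t _ (D.mul_mem (hD _ hc) hd))
    | zero => rw [mul_zero]; exact zero_mem _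
    | add s t _ _ hs ht => rw [mul_add]; exact add_mem hs ht
    | neg s _ hs => rw [mul_neg]; exact neg_mem hs
  by_cases hg : g = 0
  · subst hg
    rw [map_zero, zero_mul, add_zero]
    exact const f (by simpa using hfg) s hs
  · have e : algebraMap k M f + algebraMap k M g * X =
        algebraMap k M g * (X - algebraMap k M (-f / g)) := by
      rw [map_div₀, map_neg]
      field_simp [hinj g hg]
      ring
    rw [e, Λ.map_mul (hinj g hg) (hX _), add_mul]
    exact add_mem (const g hg s hs) (lin _ s hs)

end

namespace IsEisenstein

variable {k K M S : Type u} [Field k] [Field K] [Algebra k K] [Field M] [Algebra k M] [Ring S]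
  {θ : K}

theorem rep_ext (h : IsEisenstein (k := k) θ) {f g f' g' : k}
    (e : algebraMap k K f + algebraMap k K g * θ = algebraMap k K f' + algebraMap k K g' * θ) :
    f = f' ∧ g = g' := by
  have := h.rep_eq_zero (f := f - f') (g := g - g') (by
    rw [map_sub, map_sub]
    linear_combination e)
  exact ⟨sub_eq_zero.1 this.1, sub_eq_zero.1 this.2⟩

/-- The linear polynomial in `X` representing an element of the extension. -/
noncomputable def linear (h : IsEisenstein (k := k) θ) (X : M) (x : K) : M :=
  algebraMap k M (h.exists_rep x).choose + algebraMap k M (h.exists_rep x).choose_spec.choose * X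

theorem linear_rep (h : IsEisenstein (k := k) θ) (X : M) (f g : k) :
    h.linear X (algebraMap k K f + algebraMap k K g * θ) =
      algebraMap k M f + algebraMap k M g * X := by
  have e := (h.exists_rep (algebraMap k K f + algebraMap k K g * θ)).choose_spec.choose_spec
  obtain ⟨e1, e2⟩ := h.rep_ext e
  exact congrArg₂ (fun a b => algebraMap k M a + algebraMap k M b * X) e1.symm e2.symm

theorem linear_add (h : IsEisenstein (k := k) θ) (X : M) (x y : K) :
    h.linear X (x + y) = h.linear X x + h.linear X y := by
  obtain ⟨f, g, rfl⟩ := h.exists_rep x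
  obtain ⟨f', g', rfl⟩ := h.exists_rep y
  have e : algebraMap k K f + algebraMap k K g * θ + (algebraMap k K f' + algebraMap k K g' * θ) =
      algebraMap k K (f + f') + algebraMap k K (g + g') * θ := by
    rw [map_add, map_add]
    ring
  rw [e, linear_rep, linear_rep, linear_rep, map_add, map_add]
  ring

theorem linear_algebraMap (h : IsEisenstein (k := k) θ) (X : M) (f : k) :
    h.linear X (algebraMap k K f) = algebraMap k M f := by
  have := h.linear_rep X f 0
  simpa using this

theorem exists_linear_mul (h : IsEisenstein (k := k) θ) (X : M) (x y : K) :
    ∃ c : k, h.linear X x * h.linear X y =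
      h.linear X (x * y) + algebraMap k M c * (X ^ 2 + X + 1) := by
  obtain ⟨f, g, rfl⟩ := h.exists_rep x
  obtain ⟨f', g', rfl⟩ := h.exists_rep y
  have e : (algebraMap k K f + algebraMap k K g * θ) * (algebraMap k K f' + algebraMap k K g' * θ) =
      algebraMap k K (f * f' - g * g') + algebraMap k K (f * g' + g * f' - g * g') * θ := by
    simp only [map_add, map_mul, map_sub]
    linear_combination algebraMap k K g * algebraMap k K g' * h.root
  refine ⟨g * g', ?_⟩
  rw [e, linear_rep, linear_rep, linear_rep]
  simp only [map_add, map_mul, map_sub]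
  ring

variable {Λ : MilnorRep M S} {X : M} {D : Subring S}

theorem linear_ne_zero (h : IsEisenstein (k := k) θ)
    (hX : ∀ f g : k, algebraMap k M f + algebraMap k M g * X = 0 → f = 0 ∧ g = 0) {x : K}
    (hx : x ≠ 0) : h.linear X x ≠ 0 := by
  obtain ⟨f, g, rfl⟩ := h.exists_rep x
  intro h0
  rw [linear_rep] at h0
  obtain ⟨rfl, rfl⟩ := hX f g h0
  simp at hx

theorem linear_mul_mem (h : IsEisenstein (k := k) θ)
    (hX : ∀ f g : k, algebraMap k M f + algebraMap k M g * X = 0 → f = 0 ∧ g = 0)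
    (hD : ∀ f : k, f ≠ 0 → Λ (algebraMap k M f) ∈ D) {x : K} (hx : x ≠ 0) {s : S}
    (hs : s ∈ linearSpan k Λ X D) : Λ (h.linear X x) * s ∈ linearSpan k Λ X D := by
  obtain ⟨f, g, rfl⟩ := h.exists_rep x
  rw [linear_rep]
  refine mul_mem_linearSpan (fun r hr => ?_) hD ?_ hs
  · have := hX (-r) 1 (by rw [map_neg, map_one, ← hr]; ring)
    exact one_ne_zero this.2
  · by_contra! hfg
    simp [hfg.1, hfg.2] at hx

theorem prod_mul_mem (h : IsEisenstein (k := k) θ)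
    (hX : ∀ f g : k, algebraMap k M f + algebraMap k M g * X = 0 → f = 0 ∧ g = 0)
    (hD : ∀ f : k, f ≠ 0 → Λ (algebraMap k M f) ∈ D) (l : List Kˣ) {s : S}
    (hs : s ∈ linearSpan k Λ X D) :
    (l.map fun u : Kˣ => Λ (h.linear X u)).prod * s ∈ linearSpan k Λ X D := by
  induction l with
  | nil => simpa using hs
  | cons u l ih =>
    rw [List.map_cons, List.prod_cons, mul_assoc]
    exact h.linear_mul_mem hX hD u.ne_zero ih

theorem mul_prod_mem (h : IsEisenstein (k := k) θ)
    (hX : ∀ f g : k, algebraMap k M f + algebraMap k M g * X = 0 → f = 0 ∧ g = 0)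
    (hD : ∀ f : k, f ≠ 0 → Λ (algebraMap k M f) ∈ D) {p : M} (hp : p ≠ 0) (l : List Kˣ) {s : S}
    (hs : Λ p * s ∈ linearSpan k Λ X D) :
    Λ p * ((l.map fun u : Kˣ => Λ (h.linear X u)).prod * s) ∈ linearSpan k Λ X D := by
  induction l with
  | nil => simpa using hs
  | cons u l ih =>
    rw [List.map_cons, List.prod_cons, mul_assoc, ← mul_assoc,
      Λ.anticomm hp (h.linear_ne_zero hX u.ne_zero), neg_mul, mul_assoc]
    exact neg_mem (h.linear_mul_mem hX hD u.ne_zero ih)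

theorem mul_sub_mem (h : IsEisenstein (k := k) θ)
    (hX : ∀ f g : k, algebraMap k M f + algebraMap k M g * X = 0 → f = 0 ∧ g = 0)
    (hπ : X ^ 2 + X + 1 ≠ 0) (hD : ∀ f : k, f ≠ 0 → Λ (algebraMap k M f) ∈ D) {x y : K}
    (hx : x ≠ 0) (hy : y ≠ 0) {s : S} (hs : s ∈ linearSpan k Λ X D) :
    Λ (X ^ 2 + X + 1) * ((Λ (h.linear X x) + Λ (h.linear X y) - Λ (h.linear X (x * y))) * s) ∈
      linearSpan k Λ X D := by
  obtain ⟨c, hc⟩ := h.exists_linear_mul X x y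
  have hx' := h.linear_ne_zero hX hx
  have hy' := h.linear_ne_zero hX hy
  have hz' := h.linear_ne_zero hX (mul_ne_zero hx hy)
  have hxy := mul_ne_zero hx' hy'
  by_cases c0 : c = 0
  · rw [c0, map_zero, zero_mul, add_zero] at hc
    rw [← hc, Λ.map_mul hx' hy', sub_self, zero_mul, mul_zero]
    exact zero_mem _
  have hc' : algebraMap k M c ≠ 0 := (map_ne_zero _).2 c0
  have hcπ := mul_ne_zero hc' hπ
  have st := Λ.steinberg (div_ne_zero hz' hxy) (div_ne_zero hcπ hxy) (by
    rw [← add_div, ← hc, div_self hxy])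
  rw [Λ.map_div hz' hxy, Λ.map_div hcπ hxy, Λ.map_mul hx' hy', Λ.map_mul hc' hπ] at st
  have Lx := fun s hs => h.linear_mul_mem hX hD hx (s := s) hs
  have Ly := fun s hs => h.linear_mul_mem hX hD hy (s := s) hs
  have Lz := fun s hs => h.linear_mul_mem hX hD (mul_ne_zero hx hy) (s := s) hs
  have Lc := fun s hs => h.linear_mul_mem hX hD ((map_ne_zero (algebraMap k K)).2 c0) (s := s) hs
  simp only [h.linear_algebraMap X c] at Lc
  have ax := Λ.anticomm hπ hx'
  have ay := Λ.anticomm hπ hy'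
  have az := Λ.anticomm hπ hz'
  generalize Λ (X ^ 2 + X + 1) = P at *
  generalize Λ (h.linear X x) = A at *
  generalize Λ (h.linear X y) = B at *
  generalize Λ (h.linear X (x * y)) = Z at *
  generalize Λ (algebraMap k M c) = C at *
  have key : P * ((A + B - Z) * s) = (A + B - Z) * ((C - A - B) * s) := by
    have e : P * (A + B - Z) = -((A + B - Z) * P) := by
      rw [mul_sub, mul_add, ax, ay, az]
      noncomm_ring
    have e2 : (A + B - Z) * P = -((A + B - Z) * (C - A - B)) := by
      rw [← sub_eq_zero, ← neg_eq_zero, ← st]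
      noncomm_ring
    rw [← mul_assoc, e, e2, neg_neg, mul_assoc]
  have m1 : (C - A - B) * s ∈ linearSpan k Λ X D := by
    rw [sub_mul, sub_mul]
    exact sub_mem (sub_mem (Lc _ hs) (Lx _ hs)) (Ly _ hs)
  rw [key, sub_mul, add_mul]
  exact sub_mem (add_mem (Lx _ m1) (Ly _ m1)) (Lz _ m1)

theorem mul_prod_mem_linearSpan (h : IsEisenstein (k := k) θ) (hK : KillsFive K)
    (hX : ∀ f g : k, algebraMap k M f + algebraMap k M g * X = 0 → f = 0 ∧ g = 0)
    (hπ : X ^ 2 + X + 1 ≠ 0) (hD : ∀ f : k, f ≠ 0 → Λ (algebraMap k M f) ∈ D)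
    (a b c d e : kˣ) :
    Λ (X ^ 2 + X + 1) * (Λ (algebraMap k M a) * Λ (algebraMap k M b) * Λ (algebraMap k M c) *
      Λ (algebraMap k M d) * Λ (algebraMap k M e)) ∈ linearSpan k Λ X D := by
  let φ : List Kˣ → S ⧸ linearSpan k Λ X D := fun l =>
    QuotientAddGroup.mk (Λ (X ^ 2 + X + 1) * (l.map fun u : Kˣ => Λ (h.linear X u)).prod)
  have h1 : (1 : S) ∈ linearSpan k Λ X D := AddSubgroup.subset_closure (Or.inl D.one_mem)
  have hφ : φ ∈ symbolFamilies K (S ⧸ linearSpan k Λ X D) := by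
    refine ⟨fun l => ?_, fun l₁ l₂ u v => ?_, fun l₁ l₂ u v huv => ?_⟩
    · have h3 := Λ.three_mul (Λ (X ^ 2 + X + 1) * (l.map fun u : Kˣ => Λ (h.linear X u)).prod)
      have : 3 • (Λ (X ^ 2 + X + 1) * (l.map fun u : Kˣ => Λ (h.linear X u)).prod) = 0 := by
        rw [← h3, nsmul_eq_mul, Nat.cast_ofNat]
      exact congrArg (QuotientAddGroup.mk (s := linearSpan k Λ X D)) this
    · refine ((QuotientAddGroup.eq (s := linearSpan k Λ X D)).2 ?_)
      have := h.mul_prod_mem hX hD hπ l₁ (h.mul_sub_mem hX hπ hD u.ne_zero v.ne_zero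
        (h.prod_mul_mem hX hD l₂ h1))
      convert this using 1
      simp only [List.map_append, List.prod_append, List.map_cons, List.prod_cons, Units.val_mul]
      noncomm_ring
    · have st := Λ.steinberg (h.linear_ne_zero hX u.ne_zero) (h.linear_ne_zero hX v.ne_zero) (by
        rw [← h.linear_add, huv, ← map_one (algebraMap k K), h.linear_algebraMap, map_one])
      have : ((l₁ ++ u :: v :: l₂).map fun u : Kˣ => Λ (h.linear X u)).prod = 0 := by
        simp only [List.map_append, List.prod_append, List.map_cons, List.prod_cons]
        rw [← mul_assoc (Λ _) (Λ _), st, zero_mul, mul_zero]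
      simp only [φ, this, mul_zero]
      rfl
  let i : kˣ → Kˣ := Units.map (algebraMap k K)
  have := hK.symbolFamilies_eq_zero hφ (i a) (i b) (i c) (i d) (i e)
  have := (QuotientAddGroup.eq_zero_iff _).1 this
  have hi : ∀ u, h.linear X (i u : K) = algebraMap k M u := fun u => h.linear_algebraMap X u
  simpa [hi, mul_assoc] using this

end IsEisenstein

section

variable {k : Type u} [Field k]

theorem HahnSeries.order_eq_of_coeff_ne_zero {x : LaurentSeries k} {n : ℤ} (hn : x.coeff n ≠ 0)
    (h : ∀ m < n, x.coeff m = 0) : x.order = n := by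
  have hx : x ≠ 0 := by
    rintro rfl
    simp at hn
  refine le_antisymm (HahnSeries.order_le_of_coeff_ne_zero hn) (not_lt.1 fun hlt => ?_)
  exact HahnSeries.coeff_order_eq_zero.not.2 hx (h _ hlt)

/-- The expansion of the variable at a place of degree one of the rational function field. -/
noncomputable def expansion : Option k → LaurentSeries k
  | some r => algebraMap k (LaurentSeries k) r + HahnSeries.single 1 1
  | none => HahnSeries.single (-1) 1

theorem transcendental_expansion (v : Option k) : Transcendental k (expansion v) := by
  have h1 : Transcendental k (HahnSeries.single 1 1 : LaurentSeries k) := by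
    have e : (Polynomial.aeval (R := k) (HahnSeries.single 1 1 : LaurentSeries k)).toRingHom =
        algebraMap (Polynomial k) (LaurentSeries k) :=
      Polynomial.ringHom_ext (fun a => by simp [LaurentSeries.algebraMap_apply]) (by simp)
    rw [transcendental_iff_injective]
    intro p q hpq
    exact FaithfulSMul.algebraMap_injective (Polynomial k) (LaurentSeries k)
      (by rw [← e]; exact hpq)
  cases v with
  | some r =>
    refine fun h => h1 ?_
    have := h.sub (isAlgebraic_algebraMap r)
    rwa [expansion, add_sub_cancel_left] at this
  | none =>
    refine fun h => h1 ?_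
    have := h.inv
    rwa [expansion, HahnSeries.inv_single, inv_one, neg_neg] at this

/-- The expansion of rational functions at a place of degree one. -/
noncomputable def ratFuncExpansion (v : Option k) : RatFunc k →ₐ[k] LaurentSeries k :=
  RatFunc.liftAlgHom (Polynomial.aeval (expansion v))
    (nonZeroDivisors_le_comap_nonZeroDivisors_of_injective _
      (transcendental_iff_injective.1 (transcendental_expansion v)))

theorem ratFuncExpansion_X (v : Option k) : ratFuncExpansion v RatFunc.X = expansion v := by
  rw [ratFuncExpansion, ← RatFunc.algebraMap_X, ← div_one (algebraMap _ (RatFunc k) _),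
    ← map_one (algebraMap (Polynomial k) (RatFunc k)), RatFunc.liftAlgHom_apply_div]
  simp

theorem order_ratFuncExpansion_X_sub (v : Option k) (s : k) [DecidableEq (Option k)] :
    (ratFuncExpansion v (RatFunc.X - algebraMap k (RatFunc k) s)).order =
      (if v = some s then 1 else 0) - (if v = none then 1 else 0) := by
  rw [map_sub, ratFuncExpansion_X, AlgHom.commutes, LaurentSeries.algebraMap_apply,
    HahnSeries.C_apply]
  cases v with
  | some r =>
    rw [expansion, LaurentSeries.algebraMap_apply, HahnSeries.C_apply]
    by_cases hrs : r = s
    · subst hrs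
      simp
    · have : r - s ≠ 0 := sub_ne_zero.2 hrs
      have : ∀ m < (0 : ℤ), m ≠ 1 := by intros; omega
      simp only [Option.some.injEq, hrs, reduceCtorEq, if_false, sub_zero]
      refine HahnSeries.order_eq_of_coeff_ne_zero ?_ fun m hm => ?_
      · simpa [HahnSeries.coeff_single]
      · simp [hm.ne, this m hm]
  | none =>
    rw [expansion]
    simp only [reduceCtorEq, if_false, if_true, zero_sub]
    refine HahnSeries.order_eq_of_coeff_ne_zero ?_ fun m hm => ?_
    · simp
    · simp [hm.ne, show m ≠ 0 by omega]

theorem order_ratFuncExpansion_quadratic (hk : ∀ f : k, f ^ 2 + f + 1 ≠ 0) (v : Option k)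
    [DecidableEq (Option k)] :
    (ratFuncExpansion v (RatFunc.X ^ 2 + RatFunc.X + 1)).order = if v = none then -2 else 0 := by
  rw [map_add, map_add, map_pow, ratFuncExpansion_X, map_one, ← HahnSeries.single_zero_one]
  cases v with
  | some r =>
    have e : expansion (some r) ^ 2 + expansion (some r) + HahnSeries.single 0 1 =
        HahnSeries.single 0 (r ^ 2 + r + 1) + HahnSeries.single 1 (2 * r + 1) +
          HahnSeries.single 2 1 := by
      have e1 : (HahnSeries.single 1 (2 * r + 1) : LaurentSeries k) =
          HahnSeries.C (2 * r + 1) * HahnSeries.single 1 1 := by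
        rw [HahnSeries.C_apply, HahnSeries.single_mul_single, zero_add, mul_one]
      have e2 : (HahnSeries.single 2 1 : LaurentSeries k) = HahnSeries.single 1 1 ^ 2 := by simp
      rw [expansion, LaurentSeries.algebraMap_apply, e1, e2, HahnSeries.single_zero_one,
        ← HahnSeries.C_apply]
      simp only [map_add, map_mul, map_pow, map_one, map_ofNat]
      ring
    rw [e]
    simp only [reduceCtorEq, if_false]
    refine HahnSeries.order_eq_of_coeff_ne_zero ?_ fun m hm => ?_
    · simpa [HahnSeries.coeff_single] using hk r
    · simp [hm.ne, show m ≠ 1 by omega, show m ≠ 2 by omega]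
  | none =>
    rw [expansion, pow_two, HahnSeries.single_mul_single, if_pos rfl]
    refine HahnSeries.order_eq_of_coeff_ne_zero ?_ fun m hm => ?_
    · simp
    · simp [hm.ne, show m ≠ 0 by omega, show m ≠ -1 by omega]

/-- The constant families of diagonal matrices of size two. -/
def constDiagonal (k R : Type*) [Ring R] :
    R × R →+* (Option k → Matrix (Fin 2) (Fin 2) R) where
  toFun p _ := !![p.1, 0; 0, p.2]
  map_one' := by
    ext v i j
    fin_cases i <;> fin_cases j <;> rfl
  map_mul' p q := by
    ext v i j
    fin_cases i <;> fin_cases j <;> simp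
  map_zero' := by
    ext v i j
    fin_cases i <;> fin_cases j <;> rfl
  map_add' p q := by
    ext v i j
    fin_cases i <;> fin_cases j <;> simp

/-- The representation of the Milnor ring of the rational function field recording the leading
coefficients and the orders at all places of degree one. -/
noncomputable def MilnorRep.ratFunc {R : Type u} [Ring R] (L : MilnorRep k R) :
    MilnorRep (RatFunc k) (Option k → Matrix (Fin 2) (Fin 2) R) :=
  MilnorRep.pi fun v => L.laurent.comp (ratFuncExpansion v).toRingHom

theorem MilnorRep.ratFunc_apply {R : Type u} [Ring R] (L : MilnorRep k R) (x : RatFunc k)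
    (v : Option k) : L.ratFunc x v =
      !![L (ratFuncExpansion v x).leadingCoeff, ((ratFuncExpansion v x).order : R); 0,
        -L (ratFuncExpansion v x).leadingCoeff] := rfl

theorem MilnorRep.ratFunc_algebraMap {R : Type u} [Ring R] (L : MilnorRep k R) (f : k) :
    L.ratFunc (algebraMap k (RatFunc k) f) = constDiagonal k R (L f, -L f) := by
  funext v
  rw [MilnorRep.ratFunc_apply, AlgHom.commutes, LaurentSeries.algebraMap_apply,
    HahnSeries.order_C, HahnSeries.C_apply, HahnSeries.leadingCoeff_of_single, Int.cast_zero]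
  rfl

theorem MilnorRep.exists_finsupp_of_mem_linearSpan {R : Type u} [Ring R] (L : MilnorRep k R)
    {s : Option k → Matrix (Fin 2) (Fin 2) R}
    (hs : s ∈ linearSpan k L.ratFunc RatFunc.X (constDiagonal k R).range) :
    ∃ g : Option k →₀ R, (∀ v, g v = s v 0 1) ∧ Finsupp.liftAddHom (fun _ => .id R) g = 0 := by
  classical
  induction hs using AddSubgroup.closure_induction with
  | mem s hs =>
    rcases hs with ⟨p, rfl⟩ | ⟨r, _, ⟨p, rfl⟩, rfl⟩
    · exact ⟨0, fun v => rfl, map_zero _⟩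
    · refine ⟨Finsupp.single (some r) p.2 - Finsupp.single none p.2, fun v => ?_, ?_⟩
      swap
      · rw [_root_.map_sub, Finsupp.liftAddHom_apply_single, Finsupp.liftAddHom_apply_single,
          sub_self]
      have : (L.ratFunc (RatFunc.X - algebraMap k (RatFunc k) r) * constDiagonal k R p) v 0 1 =
          ((ratFuncExpansion v (RatFunc.X - algebraMap k (RatFunc k) r)).order : R) * p.2 := by
        rw [Pi.mul_apply, MilnorRep.ratFunc_apply]
        simp [constDiagonal, Matrix.mul_apply, Fin.sum_univ_two]
      rw [this, order_ratFuncExpansion_X_sub, Finsupp.sub_apply, Finsupp.single_apply,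
        Finsupp.single_apply]
      cases v <;> simp [eq_comm]
  | zero => exact ⟨0, fun v => rfl, map_zero _⟩
  | add s t _ _ hs ht =>
    obtain ⟨g, hg, hg'⟩ := hs
    obtain ⟨g', h, h'⟩ := ht
    exact ⟨g + g', fun v => by simp [hg, h], by rw [map_add, hg', h', add_zero]⟩
  | neg s _ hs =>
    obtain ⟨g, hg, hg'⟩ := hs
    exact ⟨-g, fun v => by simp [hg], by rw [_root_.map_neg, hg', neg_zero]⟩

theorem IsEisenstein.killsFive {K : Type u} [Field K] [Algebra k K] {θ : K}
    (h : IsEisenstein (k := k) θ) (hK : KillsFive K) : KillsFive k := by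
  classical
  intro R _ L a b c d e ha hb hc hd he
  have hX : ∀ f g : k, algebraMap k (RatFunc k) f + algebraMap k (RatFunc k) g * RatFunc.X = 0 →
      f = 0 ∧ g = 0 := by
    intro f g hfg
    have : (Polynomial.C f + Polynomial.C g * Polynomial.X : Polynomial k) = 0 := by
      refine transcendental_iff.1 (RatFunc.transcendental_X (K := k)) _ ?_
      simpa using hfg
    have h0 := congrArg (Polynomial.coeff · 0) this
    have h1 := congrArg (Polynomial.coeff · 1) this
    simp only [Polynomial.coeff_add, Polynomial.coeff_C_mul, Polynomial.coeff_C,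
      Polynomial.coeff_X, Polynomial.coeff_zero] at h0 h1
    simpa using And.intro h0 h1
  have hπ : (RatFunc.X ^ 2 + RatFunc.X + 1 : RatFunc k) ≠ 0 := by
    intro h0
    have := order_ratFuncExpansion_quadratic h.irreducible none
    rw [h0, map_zero, HahnSeries.order_zero] at this
    simp at this
  have hD : ∀ f : k, f ≠ 0 → L.ratFunc (algebraMap k (RatFunc k) f) ∈ (constDiagonal k R).range :=
    fun f _ => ⟨_, (L.ratFunc_algebraMap f).symm⟩
  obtain ⟨g, hg, hg'⟩ := L.exists_finsupp_of_mem_linearSpan (h.mul_prod_mem_linearSpan hK hX hπ hD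
    (.mk0 a ha) (.mk0 b hb) (.mk0 c hc) (.mk0 d hd) (.mk0 e he))
  have hg2 : g = Finsupp.single none
      (L a * L b * L c * L d * L e + L a * L b * L c * L d * L e) := by
    ext v
    rw [hg]
    simp only [Units.val_mk0, MilnorRep.ratFunc_algebraMap, ← map_mul]
    rw [Pi.mul_apply, MilnorRep.ratFunc_apply, order_ratFuncExpansion_quadratic h.irreducible,
      Finsupp.single_apply]
    cases v
    · simp [constDiagonal, Matrix.mul_apply, Fin.sum_univ_two, two_mul]
    · simp [constDiagonal, Matrix.mul_apply, Fin.sum_univ_two]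
  rw [hg2, Finsupp.liftAddHom_apply_single] at hg'
  exact L.eq_zero_of_add_self hg'

end

/-- If `F` is a field of characteristic different from `3`
with the `C_4` property, then `K_5^M(F)/3K_5^M(F) = 0`. -/
theorem kMod_five_eq_zero (F : Type u) [Field F]
    (hchar : ringChar F ≠ 3) (hC : IsCField F 4) :
    ∀ α : kMod F 3 5, α = 0 := by
  intro α
  by_cases h : ∃ ζ : F, ζ ^ 2 + ζ + 1 = 0
  · obtain ⟨ζ, hζ⟩ := h
    exact (killsFive_of_zeta hC.cubicsIsotropic_self hζ).kMod_eq_zero α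
  · obtain ⟨K, _, _, θ, hθ⟩ := exists_isEisenstein (not_exists.1 h)
    exact (hθ.killsFive (killsFive_of_zeta (hC.cubicsIsotropic hθ) hθ.root)).kMod_eq_zero α
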